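/- arXiv:1901.10315 — 2 statements merged into one kernel-verified Lean document; each statement's English description precedes it below -/
import Mathlib

section
/- Lower bound for h₁ + 2h₂: for every η ≥ η_* := 1 + log(4/3), one has π/3 + ∫_{k_min(η)}^{k_A(η)} 2·(η − V(k))^{−1/2} dk > 0.7789·π (and in particular > 2π/3). Moreover, if η ≥ 4/3 the left-hand side exceeds 0.9456·π, and if η ≥ 1.38 it exceeds π. (The left-hand side equals h₁(c) + 2h₂(c), the change of polar angle from B to A along the Abresch–Langer trajectory of energy c = e^{(η−1)/2}.) -/
open Real

noncomputable def V (k : ℝ) : ℝ := k ^ 2 - 2 * Real.log k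

theorem V_eq_sq_sub_log_sq (k : ℝ) : V k = k ^ 2 - Real.log (k ^ 2) := by
  rw [V, Real.log_pow]; norm_num

theorem V_one : V 1 = 1 := by simp [V]

theorem hasDerivAt_V {k : ℝ} (hk : 0 < k) : HasDerivAt V (2 * k - 2 / k) k := by
  have h := (hasDerivAt_pow 2 k).sub ((Real.hasDerivAt_log hk.ne').const_mul 2)
  exact h.congr_deriv (by norm_num [div_eq_mul_inv])

theorem continuousOn_V : ContinuousOn V (Set.Ioi 0) := fun _ hk =>
  (hasDerivAt_V hk).continuousAt.continuousWithinAt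

theorem one_lt_V {k : ℝ} (hk : 0 < k) (hk1 : k ≠ 1) : 1 < V k := by
  rw [V_eq_sq_sub_log_sq]
  have hne : k ^ 2 ≠ 1 := fun h => hk1 ((pow_eq_one_iff_of_nonneg hk.le two_ne_zero).1 h)
  have := Real.log_lt_sub_one_of_pos (pow_pos hk 2) hne
  linarith

theorem V_lt_V_of_lt_of_le_one {x y : ℝ} (hx : 0 < x) (hxy : x < y) (hy : y ≤ 1) :
    V y < V x := by
  have hy0 : 0 < y := hx.trans hxy
  have hlog := Real.log_lt_sub_one_of_pos (div_pos hx hy0) (by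
    rw [Ne, div_eq_one_iff_eq hy0.ne']; exact hxy.ne)
  rw [Real.log_div hx.ne' hy0.ne'] at hlog
  have hdiv : (y - x) * (y + x) ≤ 2 * (1 - x / y) := by
    have : 2 * (1 - x / y) = (y - x) * (2 / y) := by field_simp
    rw [this]
    refine mul_le_mul_of_nonneg_left ?_ (by linarith)
    rw [le_div_iff₀ hy0]; nlinarith
  unfold V
  nlinarith

theorem convexOn_V : ConvexOn ℝ (Set.Ioi 0) V := by
  have h1 : ConvexOn ℝ (Set.Ioi (0 : ℝ)) (fun k : ℝ => k ^ 2) :=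
    (even_two.convexOn_pow (𝕜 := ℝ)).subset (Set.subset_univ _) (convex_Ioi 0)
  have h2 := (strictConcaveOn_log_Ioi.concaveOn.smul (by norm_num : (0 : ℝ) ≤ 2))
  exact h1.sub h2

theorem chord_le_sub_V {a b k : ℝ} (ha : 0 < a) (hab : a < b) (hk : k ∈ Set.Icc a b) :
    (V a - V b) / (b - a) * (k - a) ≤ V a - V k := by
  have hba : 0 < b - a := by linarith
  have h := convexOn_V.2 (Set.mem_Ioi.2 ha) (Set.mem_Ioi.2 (ha.trans hab))
    (div_nonneg (by linarith [hk.2]) hba.le : 0 ≤ (b - k) / (b - a))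
    (div_nonneg (by linarith [hk.1]) hba.le : 0 ≤ (k - a) / (b - a))
    (by field_simp; ring)
  have hk' : ((b - k) / (b - a)) • a + ((k - a) / (b - a)) • b = k := by
    simp only [smul_eq_mul]; field_simp; ring
  rw [hk'] at h
  simp only [smul_eq_mul] at h
  have : (V a - V b) / (b - a) * (k - a)
      = V a - ((b - k) / (b - a) * V a + (k - a) / (b - a) * V b) := by
    field_simp; ring
  linarith

theorem V_lt_of_mem_Ioc {a b k : ℝ} (ha : 0 < a) (hab : a < b) (hV : V b < V a)
    (hk : k ∈ Set.Ioc a b) : V k < V a := by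
  have h := chord_le_sub_V ha hab ⟨hk.1.le, hk.2⟩
  have : 0 < (V a - V b) / (b - a) * (k - a) :=
    mul_pos (div_pos (by linarith) (by linarith)) (by linarith [hk.1])
  linarith

theorem intervalIntegrable_inv_sqrt_sub_V {a b : ℝ} (ha : 0 < a) (hab : a < b)
    (hV : V b < V a) :
    IntervalIntegrable (fun k => 2 * (√(V a - V k))⁻¹) MeasureTheory.volume a b := by
  set c := (V a - V b) / (b - a) with hc
  have hc0 : 0 < c := div_pos (by linarith) (by linarith)
  have hg : IntervalIntegrable (fun k => 2 * (√c)⁻¹ * (k - a) ^ (-(1 / 2) : ℝ))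
      MeasureTheory.volume a b := by
    have h := (intervalIntegral.intervalIntegrable_rpow' (a := 0) (b := b - a)
      (r := -(1 / 2)) (by norm_num)).comp_sub_right a
    simp only [zero_add, sub_add_cancel] at h
    exact h.const_mul _
  have hcont : ContinuousOn (fun k => 2 * (√(V a - V k))⁻¹) (Set.Ioc a b) := by
    refine continuousOn_const.mul (ContinuousOn.inv₀ ?_ ?_)
    · exact (continuousOn_const.sub (continuousOn_V.mono fun k hk => ha.trans hk.1)).sqrt
    · intro k hk
      exact (Real.sqrt_pos.2 (sub_pos.2 (V_lt_of_mem_Ioc ha hab hV hk))).ne'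
  refine hg.mono_fun' ?_ ?_
  · rw [Set.uIoc_of_le hab.le]
    exact hcont.aestronglyMeasurable measurableSet_Ioc
  · rw [Set.uIoc_of_le hab.le]
    refine (MeasureTheory.ae_restrict_iff' measurableSet_Ioc).2 (Filter.Eventually.of_forall ?_)
    intro k hk
    have hka : 0 < k - a := by linarith [hk.1]
    have h1 : (k - a) ^ (-(1 / 2) : ℝ) = (√(k - a))⁻¹ := by
      rw [Real.rpow_neg hka.le, Real.sqrt_eq_rpow]
    dsimp only
    rw [Real.norm_of_nonneg (by positivity), h1, mul_assoc, ← mul_inv, ← Real.sqrt_mul hc0.le]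
    have h2 : 0 < √(c * (k - a)) := Real.sqrt_pos.2 (mul_pos hc0 hka)
    have h3 := Real.sqrt_le_sqrt (chord_le_sub_V ha hab ⟨hk.1.le, hk.2⟩)
    gcongr

theorem log_le_half_sub_inv {u : ℝ} (hu : 1 ≤ u) : Real.log u ≤ (u - u⁻¹) / 2 := by
  rw [← Real.sinh_log (by linarith)]
  exact Real.self_le_sinh_iff.2 (Real.log_nonneg hu)

theorem sq_sub_one_sq_le {k : ℝ} (hk : 1 ≤ k) : (k ^ 2 - 1) ^ 2 ≤ 2 * k ^ 2 * (V k - 1) := by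
  have hk0 : 0 < k ^ 2 := by positivity
  have h := log_le_half_sub_inv (u := k ^ 2) (by nlinarith)
  have h2 := mul_le_mul_of_nonneg_left h hk0.le
  have h3 : k ^ 2 * (k ^ 2)⁻¹ = 1 := mul_inv_cancel₀ hk0.ne'
  rw [V_eq_sq_sub_log_sq]
  nlinarith

theorem le_sq_sub_one_sq {k : ℝ} (hk0 : 0 < k) (hk : k ≤ 1) :
    2 * k ^ 2 * (V k - 1) ≤ (k ^ 2 - 1) ^ 2 := by
  have hk2 : 0 < k ^ 2 := by positivity
  have h := log_le_half_sub_inv (u := (k ^ 2)⁻¹) (one_le_inv_iff₀.2 ⟨hk2, by nlinarith⟩)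
  rw [Real.log_inv, inv_inv] at h
  have h2 := mul_le_mul_of_nonneg_left h hk2.le
  have h3 : k ^ 2 * (k ^ 2)⁻¹ = 1 := mul_inv_cancel₀ hk2.ne'
  rw [V_eq_sq_sub_log_sq]
  nlinarith

theorem one_sub_sq_sq_le {n k : ℝ} (hn : 0 ≤ n) (hk0 : 0 < k) (hk1 : k ≤ 1)
    (hcub : ∀ x ∈ Set.Ioo k 1, x * (1 + x ^ 2) ≤ 2 * (x + n * (1 - x ^ 2)) ^ 3) :
    (1 - k ^ 2) ^ 2 ≤ 2 * (V k - 1) * (k + n * (1 - k ^ 2)) ^ 2 := by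
  have hpos : ∀ x ∈ Set.Icc k 1, 0 < x + n * (1 - x ^ 2) := fun x hx => by
    have : 0 < x := hk0.trans_le hx.1
    have : 0 ≤ 1 - x ^ 2 := by nlinarith [hx.2]
    positivity
  have hder : ∀ x ∈ Set.Icc k 1, HasDerivAt
      (fun x => V x - (1 / 2) * ((1 - x ^ 2) / (x + n * (1 - x ^ 2))) ^ 2)
      (2 * x - 2 / x + (1 - x ^ 2) * (1 + x ^ 2) / (x + n * (1 - x ^ 2)) ^ 3) x := fun x hx => by
    have hx0 : 0 < x := hk0.trans_le hx.1
    have hD := hpos x hx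
    have h1 : HasDerivAt (fun x : ℝ => 1 - x ^ 2) (-(2 * x)) x := by
      simpa using (hasDerivAt_pow 2 x).const_sub 1
    have h2 := (hasDerivAt_id x).add (h1.const_mul n)
    have h3 := (((h1.div h2 hD.ne').pow 2).const_mul (1 / 2))
    have h4 := (hasDerivAt_V hx0).sub h3
    refine h4.congr_deriv ?_
    have hnum : -(2 * x) * (x + n * (1 - x ^ 2)) - (1 - x ^ 2) * (1 + n * -(2 * x))
        = -(1 + x ^ 2) := by ring
    simp only [Pi.add_apply, Pi.div_apply, id_eq, hnum, Nat.reduceSub, pow_one, Nat.cast_ofNat]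
    generalize x + n * (1 - x ^ 2) = D at hD
    field_simp
    ring
  have hanti := antitoneOn_of_deriv_nonpos (convex_Icc k 1)
    (fun x hx => (hder x hx).continuousAt.continuousWithinAt)
    (fun x hx => (hder x (interior_subset hx)).differentiableAt.differentiableWithinAt)
    (fun x hx => by
      rw [(hder x (interior_subset hx)).deriv]
      rw [interior_Icc] at hx
      have hx0 : 0 < x := hk0.trans hx.1
      have hD := hpos x ⟨hx.1.le, hx.2.le⟩
      have hc := hcub x hx
      have h1 : 0 ≤ 1 - x ^ 2 := by nlinarith [hx.2]
      have h2 : (1 + x ^ 2) / (x + n * (1 - x ^ 2)) ^ 3 ≤ 2 / x := by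
        rw [div_le_div_iff₀ (by positivity) hx0]; linarith
      have h3 : 2 * x - 2 / x = -((1 - x ^ 2) * (2 / x)) := by field_simp; ring
      rw [h3, mul_div_assoc]
      nlinarith [mul_le_mul_of_nonneg_left h2 h1])
  have h := hanti (Set.left_mem_Icc.2 hk1) (Set.right_mem_Icc.2 hk1) hk1
  have hD := hpos k (Set.left_mem_Icc.2 hk1)
  simp only [V_one] at h
  norm_num at h
  rw [div_pow] at h
  have h' : (1 - k ^ 2) ^ 2 / (k + n * (1 - k ^ 2)) ^ 2 ≤ 2 * (V k - 1) := by linarith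
  rwa [div_le_iff₀ (by positivity)] at h'

theorem hasDerivAt_arcsin_sqrt_V_sub_one {η k : ℝ} (hk : 0 < k) (h1 : 1 < V k) (h2 : V k < η) :
    HasDerivAt (fun k => arcsin (√(V k - 1) / √(η - 1)))
      ((2 * k - 2 / k) / (2 * √(V k - 1) * √(η - V k))) k := by
  have hW : 0 < √(V k - 1) := Real.sqrt_pos.2 (by linarith)
  have hS : 0 < √(η - V k) := Real.sqrt_pos.2 (by linarith)
  have hR : 0 < √(η - 1) := Real.sqrt_pos.2 (by linarith)
  have hlt : √(V k - 1) / √(η - 1) < 1 := by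
    rw [div_lt_one hR]; exact Real.sqrt_lt_sqrt (by linarith) (by linarith)
  have hx0 : 0 < √(V k - 1) / √(η - 1) := div_pos hW hR
  have hsq : √(1 - (√(V k - 1) / √(η - 1)) ^ 2) = √(η - V k) / √(η - 1) := by
    have hη : η - 1 ≠ 0 := by linarith
    have h : 1 - (√(V k - 1) / √(η - 1)) ^ 2 = (η - V k) / (η - 1) := by
      rw [div_pow, Real.sq_sqrt (by linarith), Real.sq_sqrt (by linarith)]
      field_simp
      ring
    rw [h, Real.sqrt_div (by linarith)]
  have hd := ((hasDerivAt_V hk).sub_const 1).sqrt (by linarith : V k - 1 ≠ 0)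
  have h := (Real.hasDerivAt_arcsin (by linarith) hlt.ne).comp k (hd.div_const (√(η - 1)))
  refine h.congr_deriv ?_
  rw [hsq]
  field_simp

theorem hasDerivAt_sqrt_sub_V {η k : ℝ} (hk : 0 < k) (h : V k < η) :
    HasDerivAt (fun k => √(η - V k)) (-(2 * k - 2 / k) / (2 * √(η - V k))) k :=
  ((hasDerivAt_V hk).const_sub η).sqrt (by linarith)

theorem left_integral_lower_bound {a p n : ℝ} (ha : 0 < a) (hap : a < p) (hp : p ≤ 1)
    (hn : 0 ≤ n)
    (hcub : ∀ x ∈ Set.Ioo a 1, x * (1 + x ^ 2) ≤ 2 * (x + n * (1 - x ^ 2)) ^ 3)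
    (hint : IntervalIntegrable (fun k => 2 * (√(V a - V k))⁻¹) MeasureTheory.volume a p) :
    √2 * (π / 2 - arcsin (√(V p - 1) / √(V a - 1))) - 2 * n * √(V a - V p)
      ≤ ∫ k in a..p, 2 * (√(V a - V k))⁻¹ := by
  have hVa : 1 < V a := one_lt_V ha (by linarith)
  have hR : 0 < √(V a - 1) := Real.sqrt_pos.2 (by linarith)
  have hVc : ContinuousOn V (Set.Icc a p) := continuousOn_V.mono fun k hk => ha.trans_le hk.1
  have hmain := intervalIntegral.sub_le_integral_of_hasDeriv_right_of_le (a := a) (b := p)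
    (g := fun k => -(√2 * arcsin (√(V k - 1) / √(V a - 1))) - 2 * n * √(V a - V k))
    (g' := fun k => -(√2 * ((2 * k - 2 / k) / (2 * √(V k - 1) * √(V a - V k))))
      - 2 * n * (-(2 * k - 2 / k) / (2 * √(V a - V k))))
    (φ := fun k => 2 * (√(V a - V k))⁻¹) hap.le
    (by
      refine (ContinuousOn.neg (continuousOn_const.mul
        (Real.continuous_arcsin.comp_continuousOn ?_))).sub (continuousOn_const.mul ?_)
      · exact (hVc.sub continuousOn_const).sqrt.div_const _
      · exact (continuousOn_const.sub hVc).sqrt)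
    (fun k hk => by
      have hk0 : 0 < k := ha.trans hk.1
      have h1 := one_lt_V hk0 (by linarith [hk.2])
      have h2 := V_lt_V_of_lt_of_le_one ha hk.1 (by linarith [hk.2])
      exact (((hasDerivAt_arcsin_sqrt_V_sub_one hk0 h1 h2).const_mul (√2)).neg.sub
        ((hasDerivAt_sqrt_sub_V hk0 h2).const_mul (2 * n))).hasDerivWithinAt)
    ((intervalIntegrable_iff_integrableOn_Icc_of_le hap.le).1 hint)
    (fun k hk => by
      have hk0 : 0 < k := ha.trans hk.1
      have hk1 : k < 1 := by linarith [hk.2]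
      have h1 := one_lt_V hk0 hk1.ne
      have h2 := V_lt_V_of_lt_of_le_one ha hk.1 hk1.le
      have hW : 0 < √(V k - 1) := Real.sqrt_pos.2 (by linarith)
      have hS : 0 < √(V a - V k) := Real.sqrt_pos.2 (by linarith)
      have hW2 : √(V k - 1) ^ 2 = V k - 1 := Real.sq_sqrt (by linarith)
      have h22 : √(2 : ℝ) ^ 2 = 2 := Real.sq_sqrt (by norm_num)
      have hk2 : 0 ≤ 1 - k ^ 2 := by nlinarith
      have hkey := one_sub_sq_sq_le hn hk0 hk1.le
        (fun x hx => hcub x ⟨hk.1.trans hx.1, hx.2⟩)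
      have hle : 1 - k ^ 2 ≤ √2 * √(V k - 1) * (k + n * (1 - k ^ 2)) := by
        refine le_of_sq_le_sq ?_ (by positivity)
        rw [mul_pow, mul_pow, hW2, h22]
        exact hkey
      have hid : -(√2 * ((2 * k - 2 / k) / (2 * √(V k - 1) * √(V a - V k))))
          - 2 * n * (-(2 * k - 2 / k) / (2 * √(V a - V k)))
          = (2 * (√(V a - V k))⁻¹) * ((1 - k ^ 2) * (√2 - 2 * n * √(V k - 1))
            / (2 * k * √(V k - 1))) := by
        field_simp
        ring
      rw [hid]
      refine mul_le_of_le_one_right (by positivity) ?_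
      rw [div_le_one (by positivity)]
      linear_combination √2 * hle + √(V k - 1) * (k + n * (1 - k ^ 2)) * h22)
  simp only [sub_self, Real.sqrt_zero, div_self hR.ne', Real.arcsin_one] at hmain
  linarith

theorem right_integral_lower_bound {η b : ℝ} (hb : 1 ≤ b)
    (hlt : ∀ k ∈ Set.Icc 1 b, V k < η)
    (hint : IntervalIntegrable (fun k => 2 * (√(η - V k))⁻¹) MeasureTheory.volume 1 b) :
    √2 * arcsin (√(V b - 1) / √(η - 1)) ≤ ∫ k in (1 : ℝ)..b, 2 * (√(η - V k))⁻¹ := by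
  have hVc : ContinuousOn V (Set.Icc 1 b) :=
    continuousOn_V.mono fun k hk => zero_lt_one.trans_le hk.1
  have hmain := intervalIntegral.sub_le_integral_of_hasDeriv_right_of_le (a := 1) (b := b)
    (g := fun k => √2 * arcsin (√(V k - 1) / √(η - 1)))
    (g' := fun k => √2 * ((2 * k - 2 / k) / (2 * √(V k - 1) * √(η - V k))))
    (φ := fun k => 2 * (√(η - V k))⁻¹) hb
    (continuousOn_const.mul (Real.continuous_arcsin.comp_continuousOn
      ((hVc.sub continuousOn_const).sqrt.div_const _)))
    (fun k hk => by
      have hk0 : 0 < k := zero_lt_one.trans hk.1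
      exact ((hasDerivAt_arcsin_sqrt_V_sub_one hk0 (one_lt_V hk0 hk.1.ne')
        (hlt k ⟨hk.1.le, hk.2.le⟩)).const_mul (√2)).hasDerivWithinAt)
    ((intervalIntegrable_iff_integrableOn_Icc_of_le hb).1 hint)
    (fun k hk => by
      have hk0 : 0 < k := zero_lt_one.trans hk.1
      have h1 := one_lt_V hk0 hk.1.ne'
      have h2 := hlt k ⟨hk.1.le, hk.2.le⟩
      have hW : 0 < √(V k - 1) := Real.sqrt_pos.2 (by linarith)
      have hS : 0 < √(η - V k) := Real.sqrt_pos.2 (by linarith)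
      have hW2 : √(V k - 1) ^ 2 = V k - 1 := Real.sq_sqrt (by linarith)
      have h22 : √(2 : ℝ) ^ 2 = 2 := Real.sq_sqrt (by norm_num)
      have hle : k ^ 2 - 1 ≤ √2 * k * √(V k - 1) := by
        refine le_of_sq_le_sq ?_ (by positivity)
        rw [mul_pow, mul_pow, hW2, h22]
        exact sq_sub_one_sq_le hk.1.le
      have hid : √2 * ((2 * k - 2 / k) / (2 * √(V k - 1) * √(η - V k)))
          = (2 * (√(η - V k))⁻¹) * ((k ^ 2 - 1) * √2 / (2 * k * √(V k - 1))) := by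
        field_simp
      rw [hid]
      refine mul_le_of_le_one_right (by positivity) ?_
      rw [div_le_one (by positivity)]
      linear_combination √2 * hle + k * √(V k - 1) * h22)
  simpa [V_one] using hmain

theorem sub_V_le_tangent {η b k : ℝ} (hb : 0 < b) (hk : 0 < k) :
    η - V k ≤ η + 2 * Real.log b - 2 + b⁻¹ ^ 2 - (k - b⁻¹) ^ 2 := by
  have h := Real.log_le_sub_one_of_pos (div_pos hk hb)
  rw [Real.log_div hk.ne' hb.ne', div_eq_mul_inv] at h
  unfold V
  nlinarith

theorem tangent_integral_lower_bound {a b R : ℝ} (ha : 0 < a) (hab : a < b) (hR : 0 < R)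
    (hV : V b < V a) (hR2 : R ^ 2 = V a + 2 * Real.log b - 2 + b⁻¹ ^ 2) :
    2 * (arcsin ((b - b⁻¹) / R) - arcsin ((a - b⁻¹) / R))
      ≤ ∫ k in a..b, 2 * (√(V a - V k))⁻¹ := by
  have hmain := intervalIntegral.sub_le_integral_of_hasDeriv_right_of_le (a := a) (b := b)
    (g := fun k => 2 * arcsin ((k - b⁻¹) / R))
    (g' := fun k => 2 * (√(R ^ 2 - (k - b⁻¹) ^ 2))⁻¹)
    (φ := fun k => 2 * (√(V a - V k))⁻¹) hab.le
    (continuousOn_const.mul (Real.continuous_arcsin.comp_continuousOn (by fun_prop)))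
    (fun k hk => by
      have hk0 : 0 < k := ha.trans hk.1
      have h1 := V_lt_of_mem_Ioc ha hab hV ⟨hk.1, hk.2.le⟩
      have h2 := sub_V_le_tangent (η := V a) (ha.trans hab) hk0
      have hS : 0 < R ^ 2 - (k - b⁻¹) ^ 2 := by linarith
      have habs := abs_lt_of_sq_lt_sq' (by linarith : (k - b⁻¹) ^ 2 < R ^ 2) hR.le
      have hm1 : (k - b⁻¹) / R ≠ -1 := by
        have : -1 < (k - b⁻¹) / R := by rw [lt_div_iff₀ hR]; linarith
        exact this.ne'
      have hm2 : (k - b⁻¹) / R ≠ 1 := by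
        have : (k - b⁻¹) / R < 1 := by rw [div_lt_one hR]; linarith
        exact this.ne
      have hsq : √(1 - ((k - b⁻¹) / R) ^ 2) = √(R ^ 2 - (k - b⁻¹) ^ 2) / R := by
        have h : 1 - ((k - b⁻¹) / R) ^ 2 = (R ^ 2 - (k - b⁻¹) ^ 2) / R ^ 2 := by field_simp
        rw [h, Real.sqrt_div hS.le, Real.sqrt_sq hR.le]
      have h := ((Real.hasDerivAt_arcsin hm1 hm2).comp k
        (((hasDerivAt_id k).sub_const b⁻¹).div_const R)).const_mul 2
      refine (h.congr_deriv ?_).hasDerivWithinAt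
      have := Real.sqrt_pos.2 hS
      rw [hsq]
      field_simp)
    ((intervalIntegrable_iff_integrableOn_Icc_of_le hab.le).1
      (intervalIntegrable_inv_sqrt_sub_V ha hab hV))
    (fun k hk => by
      have hk0 : 0 < k := ha.trans hk.1
      have h1 := V_lt_of_mem_Ioc ha hab hV ⟨hk.1, hk.2.le⟩
      have h2 := sub_V_le_tangent (η := V a) (ha.trans hab) hk0
      have hS : 0 < √(V a - V k) := Real.sqrt_pos.2 (by linarith)
      have h3 : √(V a - V k) ≤ √(R ^ 2 - (k - b⁻¹) ^ 2) := Real.sqrt_le_sqrt (by linarith)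
      gcongr)
  simpa only [mul_sub] using hmain

theorem bernstein_terms_nonneg {u v : ℝ} (hu : 0 ≤ u) (hv : 0 ≤ v) :
    0 ≤ v ^ 5 ∧ 0 ≤ u * v ^ 4 ∧ 0 ≤ u ^ 2 * v ^ 3 ∧ 0 ≤ u ^ 3 * v ^ 2 ∧ 0 ≤ u ^ 4 * v ∧
      0 ≤ u ^ 5 := by
  refine ⟨?_, ?_, ?_, ?_, ?_, ?_⟩ <;> positivity

theorem cubic_ineq_of_mem_Ioo {x : ℝ} (hx : x ∈ Set.Ioo (0.56 : ℝ) 1) :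
    x * (1 + x ^ 2) ≤ 2 * (x + 0.23 * (1 - x ^ 2)) ^ 3 := by
  obtain ⟨h0, h1, h2, h3, h4, h5⟩ :=
    bernstein_terms_nonneg (sub_nonneg.2 hx.1.le) (sub_nonneg.2 hx.2.le)
  have hq : 0 ≤ 0.024334 - 0.658266 * x + 0.648732 * x ^ 2 + 1.013932 * x ^ 3
      - 0.293066 * x ^ 4 + 0.024334 * x ^ 5 := by linarith
  linarith [mul_nonneg (sub_nonneg.2 hx.2.le) hq]

theorem cubic_ineq_of_mem_unit {x : ℝ} (hx : x ∈ Set.Ioo (0 : ℝ) 1) :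
    x * (1 + x ^ 2) ≤ 2 * (x + 0.29 * (1 - x ^ 2)) ^ 3 := by
  have hq : 0 ≤ 0.048778 - 0.446622 * x + 1.147044 * x ^ 2 + 1.137844 * x ^ 3
      - 0.455822 * x ^ 4 + 0.048778 * x ^ 5 := by
    rcases le_total x 0.25 with h | h
    · obtain ⟨h0, h1, h2, h3, h4, h5⟩ := bernstein_terms_nonneg hx.1.le (sub_nonneg.2 h)
      linarith
    · obtain ⟨h0, h1, h2, h3, h4, h5⟩ :=
        bernstein_terms_nonneg (sub_nonneg.2 h) (sub_nonneg.2 hx.2.le)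
      linarith
  linarith [mul_nonneg (sub_nonneg.2 hx.2.le) hq]

theorem quintic_ineq_of_mem_Icc_left {b : ℝ} (hb : b ∈ Set.Icc (1.058 : ℝ) 1.09) :
    2 * 0.23 * b * (b ^ 2 * (b ^ 2 + 1) / 3 + (b ^ 2 - 1) ^ 2)
      < b ^ 4 - 1 + 0.0733 * b ^ 2 * (b ^ 2 + 1) := by
  obtain ⟨h0, h1, h2, h3, h4, h5⟩ :=
    bernstein_terms_nonneg (sub_nonneg.2 hb.1) (sub_nonneg.2 hb.2)
  linarith

theorem quintic_ineq_of_mem_Icc_right {b : ℝ} (hb : b ∈ Set.Icc (1.09 : ℝ) 1.8) :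
    2 * 0.29 * b * (b ^ 2 * (b ^ 2 + 1) / 3 + (b ^ 2 - 1) ^ 2)
      < b ^ 4 - 1 + 0.0733 * b ^ 2 * (b ^ 2 + 1) := by
  obtain ⟨h0, h1, h2, h3, h4, h5⟩ :=
    bernstein_terms_nonneg (sub_nonneg.2 hb.1) (sub_nonneg.2 hb.2)
  linarith

theorem two_mul_sub_one_div_add_one_le_log {u : ℝ} (hu : 1 ≤ u) :
    2 * (u - 1) / (u + 1) ≤ Real.log u := by
  have h := Real.le_log_one_add_of_nonneg (sub_nonneg.2 hu)
  convert h using 2 <;> ring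

theorem le_of_V_le {a : ℝ} (ha : 0 < a) (h : V a ≤ 1.44) : 0.56 ≤ a := by
  by_contra! hlt
  have h1 := V_lt_V_of_lt_of_le_one ha hlt (by norm_num)
  have h2 := two_mul_sub_one_div_add_one_le_log (u := (0.56 : ℝ)⁻¹) (by norm_num)
  rw [Real.log_inv] at h2
  unfold V at h1 h
  norm_num at h1 h2 h
  linarith

theorem integral_gt_of_le_one {a b : ℝ} (ha : 0 < a) (ha56 : 0.56 ≤ a) (hab : a < b)
    (hb : √3 / 2 ≤ b) (hb1 : b ≤ 1) (h : V a - V b = b ^ 2 / 3) :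
    (0.7789 - 1 / 3) * π < ∫ k in a..b, 2 * (√(V a - V k))⁻¹ := by
  have hb0 : 0 < b := ha.trans hab
  have hbb : 3 / 4 ≤ b ^ 2 := by
    have h3 : √(3 : ℝ) ^ 2 = 3 := Real.sq_sqrt (by norm_num)
    nlinarith [Real.sqrt_nonneg 3]
  have hVb : 1 ≤ V b := by
    rcases hb1.eq_or_lt with rfl | hlt
    · exact V_one.ge
    · exact (one_lt_V hb0 hlt.ne).le
  have hlow := left_integral_lower_bound (n := 0.23) ha hab hb1 (by norm_num)
    (fun x hx => cubic_ineq_of_mem_Ioo ⟨ha56.trans_lt hx.1, hx.2⟩)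
    (intervalIntegrable_inv_sqrt_sub_V ha hab (by nlinarith))
  have h2 : √(2 : ℝ) ^ 2 = 2 := Real.sq_sqrt (by norm_num)
  have h2l : 1.4142 < √(2 : ℝ) := Real.lt_sqrt_of_sq_lt (by norm_num)
  have h2u : √(2 : ℝ) < 1.41422 := (Real.sqrt_lt' (by norm_num)).2 (by norm_num)
  have hW := le_sq_sub_one_sq hb0 hb1
  have hratio : √(V b - 1) / √(V a - 1) ≤ √(2 - √2) / 2 := by
    rw [← Real.sqrt_div (by linarith), Real.sqrt_le_left (by positivity), div_pow,
      Real.sq_sqrt (by linarith), div_le_div_iff₀ (by nlinarith) (by norm_num)]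
    have hX : V b - 1 ≤ 0.0571 * b ^ 2 := by
      refine le_of_mul_le_mul_left ?_ (show 0 < 2 * b ^ 2 by positivity)
      have hb2 : b ^ 2 ≤ 1 := by nlinarith
      linarith [mul_nonneg (sub_nonneg.2 hbb) (sub_nonneg.2 hb2)]
    have hp : (V b - 1) * (2 + √2) ≤ 0.0571 * b ^ 2 * 3.41422 := by
      gcongr
      linarith
    nlinarith
  have harc : arcsin (√(V b - 1) / √(V a - 1)) ≤ π / 8 := by
    rw [Real.arcsin_le_iff_le_sin' ⟨by linarith [pi_pos], by linarith [pi_pos]⟩,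
      Real.sin_pi_div_eight]
    exact hratio
  have hS : √(V a - V b) ≤ 0.57737 := by
    rw [h]
    exact Real.sqrt_le_iff.2 ⟨by norm_num, by nlinarith⟩
  have hπ := Real.pi_gt_d4
  have : √2 * (π / 2 - π / 8) ≤ √2 * (π / 2 - arcsin (√(V b - 1) / √(V a - 1))) := by
    gcongr
  nlinarith

theorem integral_lower_bound_of_one_le {a b n : ℝ} (ha : 0 < a) (ha1 : a < 1) (hb : 1 ≤ b)
    (hn : 0 ≤ n) (hV : V b < V a)
    (hcub : ∀ x ∈ Set.Ioo a 1, x * (1 + x ^ 2) ≤ 2 * (x + n * (1 - x ^ 2)) ^ 3) :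
    √2 * (π / 2) - 2 * n * √(V a - 1) + √2 * arcsin (√(V b - 1) / √(V a - 1))
      ≤ ∫ k in a..b, 2 * (√(V a - V k))⁻¹ := by
  have hab : a < b := by linarith
  have hint := intervalIntegrable_inv_sqrt_sub_V ha hab hV
  have hint1 := hint.mono_set (c := a) (d := 1) (by
    rw [Set.uIcc_of_le ha1.le, Set.uIcc_of_le hab.le]
    exact Set.Icc_subset_Icc_right hb)
  have hint2 := hint.mono_set (c := 1) (d := b) (by
    rw [Set.uIcc_of_le hb, Set.uIcc_of_le hab.le]
    exact Set.Icc_subset_Icc_left ha1.le)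
  have h1 := left_integral_lower_bound ha ha1 le_rfl hn hcub hint1
  have h2 := right_integral_lower_bound hb
    (fun k hk => V_lt_of_mem_Ioc ha hab hV ⟨by linarith [hk.1], hk.2⟩) hint2
  rw [← intervalIntegral.integral_add_adjacent_intervals hint1 hint2]
  simp only [V_one, sub_self, Real.sqrt_zero, zero_div, Real.arcsin_zero, sub_zero] at h1
  linarith

theorem integral_gt_of_V_le {a b : ℝ} (ha : 0 < a) (ha1 : a < 1) (hb : 1 ≤ b)
    (hV : V b < V a) (hVa : V a ≤ 1.38) :
    (0.9456 - 1 / 3) * π < ∫ k in a..b, 2 * (√(V a - V k))⁻¹ := by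
  have ha56 := le_of_V_le ha (by linarith)
  have hlow := integral_lower_bound_of_one_le (n := 0.23) ha ha1 hb (by norm_num) hV
    (fun x hx => cubic_ineq_of_mem_Ioo ⟨ha56.trans_lt hx.1, hx.2⟩)
  have harc : 0 ≤ √2 * arcsin (√(V b - 1) / √(V a - 1)) :=
    mul_nonneg (Real.sqrt_nonneg _) (Real.arcsin_nonneg.2 (by positivity))
  have hR : √(V a - 1) ≤ 0.617 := Real.sqrt_le_iff.2 ⟨by norm_num, by linarith⟩
  have h2l : 1.4142 < √(2 : ℝ) := Real.lt_sqrt_of_sq_lt (by norm_num)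
  have hπ := Real.pi_gt_d4
  nlinarith

theorem integral_gt_two_pi_div_three_of_quintic {a b n : ℝ} (ha : 0 < a) (ha1 : a < 1)
    (hb : 1 ≤ b) (hn : 0 ≤ n) (h : V a - V b = b ^ 2 / 3)
    (hcub : ∀ x ∈ Set.Ioo a 1, x * (1 + x ^ 2) ≤ 2 * (x + n * (1 - x ^ 2)) ^ 3)
    (hquint : 2 * n * b * (b ^ 2 * (b ^ 2 + 1) / 3 + (b ^ 2 - 1) ^ 2)
      < b ^ 4 - 1 + 0.0733 * b ^ 2 * (b ^ 2 + 1)) :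
    2 * π / 3 < ∫ k in a..b, 2 * (√(V a - V k))⁻¹ := by
  have hb0 : 0 < b := by linarith
  have hVb : 1 ≤ V b := by
    rcases hb.eq_or_lt with rfl | hlt
    · exact V_one.ge
    · exact (one_lt_V hb0 hlt.ne').le
  have hbb : 0 < b ^ 2 := by positivity
  have hlow := integral_lower_bound_of_one_le ha ha1 hb hn (by linarith) hcub
  have hR : 0 < √(V a - 1) := Real.sqrt_pos.2 (by linarith)
  have hR2 : √(V a - 1) ^ 2 = V b - 1 + b ^ 2 / 3 := by
    rw [Real.sq_sqrt (by linarith)]; linarith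
  have hW2 : √(V b - 1) ^ 2 = V b - 1 := Real.sq_sqrt (by linarith)
  have hlog := two_mul_sub_one_div_add_one_le_log (u := b ^ 2) (by nlinarith)
  have hVu : V b - 1 ≤ (b ^ 2 - 1) ^ 2 / (b ^ 2 + 1) := by
    have : (b ^ 2 - 1) ^ 2 / (b ^ 2 + 1) = b ^ 2 - 1 - 2 * (b ^ 2 - 1) / (b ^ 2 + 1) := by
      field_simp; ring
    rw [V_eq_sq_sub_log_sq]
    linarith
  have hWl : b ^ 2 - 1 ≤ √2 * b * √(V b - 1) := by
    refine le_of_sq_le_sq ?_ (by positivity)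
    rw [mul_pow, mul_pow, hW2, Real.sq_sqrt (by norm_num)]
    exact sq_sub_one_sq_le hb
  have hRl : 0.57735 * b ≤ √(V a - 1) := by
    refine le_of_sq_le_sq ?_ hR.le
    rw [hR2]; nlinarith
  have hmain : 2 * n * √(V a - 1) ^ 2 < √2 * √(V b - 1) + 0.127 * √(V a - 1) := by
    have h1 : 2 * n * √(V a - 1) ^ 2
        ≤ 2 * n * (b ^ 2 / 3 + (b ^ 2 - 1) ^ 2 / (b ^ 2 + 1)) := by
      gcongr; linarith
    have h2 : 2 * n * (b ^ 2 / 3 + (b ^ 2 - 1) ^ 2 / (b ^ 2 + 1))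
        < (b ^ 2 - 1) / b + 0.0733 * b := by
      have e1 : 2 * n * (b ^ 2 / 3 + (b ^ 2 - 1) ^ 2 / (b ^ 2 + 1))
          = 2 * n * b * (b ^ 2 * (b ^ 2 + 1) / 3 + (b ^ 2 - 1) ^ 2) / (b * (b ^ 2 + 1)) := by
        field_simp
      have e2 : (b ^ 2 - 1) / b + 0.0733 * b
          = (b ^ 4 - 1 + 0.0733 * b ^ 2 * (b ^ 2 + 1)) / (b * (b ^ 2 + 1)) := by
        field_simp; ring
      rw [e1, e2]
      gcongr
    have h3 : (b ^ 2 - 1) / b ≤ √2 * √(V b - 1) := by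
      rw [div_le_iff₀ hb0]; linarith
    linarith
  have harc : √(V b - 1) / √(V a - 1) ≤ arcsin (√(V b - 1) / √(V a - 1)) := by
    have hle : √(V b - 1) / √(V a - 1) ≤ 1 := by
      rw [div_le_one hR]; exact Real.sqrt_le_sqrt (by linarith)
    have h0 : 0 ≤ √(V b - 1) / √(V a - 1) := by positivity
    have := Real.sin_le (Real.arcsin_nonneg.2 h0)
    rwa [Real.sin_arcsin (by linarith) hle] at this
  have harc2 := mul_le_mul_of_nonneg_left harc (Real.sqrt_nonneg 2)
  have hdiv : 2 * n * √(V a - 1) < √2 * (√(V b - 1) / √(V a - 1)) + 0.127 := by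
    have e : √2 * (√(V b - 1) / √(V a - 1)) + 0.127
        = (√2 * √(V b - 1) + 0.127 * √(V a - 1)) / √(V a - 1) := by field_simp
    rw [e, lt_div_iff₀ hR]
    linarith
  have h2l : 1.41421 < √(2 : ℝ) := Real.lt_sqrt_of_sq_lt (by norm_num)
  have hπ := Real.pi_gt_d4
  have hconst : 2 * π / 3 + 0.127 < √2 * (π / 2) := by nlinarith
  linarith

theorem le_mul_inv_of_V_eq {a b : ℝ} (ha1 : a < 1) (hb : 1.8 ≤ b)
    (h : V a - V b = b ^ 2 / 3) : a ≤ 0.4 * b⁻¹ := by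
  by_contra! hlt
  have hb0 : 0 < b := by linarith
  have hb2 : 3.24 ≤ b ^ 2 := by nlinarith
  have h1 := V_lt_V_of_lt_of_le_one (by positivity) hlt ha1.le
  have hVeq : V (0.4 * b⁻¹) = 0.16 * (b ^ 2)⁻¹ + 2 * Real.log (2.5 * b ^ 2) - Real.log (b ^ 2) := by
    have e : (0.4 : ℝ) * b⁻¹ = (2.5 * b)⁻¹ := by rw [mul_inv]; norm_num
    have e2 : V ((2.5 * b)⁻¹) = ((2.5 * b)⁻¹) ^ 2 + 2 * Real.log (2.5 * b) := by
      rw [V, Real.log_inv]; ring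
    rw [e, e2, Real.log_mul (by norm_num) hb0.ne', Real.log_mul (by norm_num) (by positivity),
      Real.log_pow, mul_inv, mul_pow, inv_pow b]
    norm_num
    ring
  have hlog := Real.log_le_sub_one_of_pos (show 0 < 2.5 * b ^ 2 / 2 ^ 3 by positivity)
  rw [Real.log_div (by positivity) (by norm_num), Real.log_pow] at hlog
  have hinv : (b ^ 2)⁻¹ ≤ 0.31 := by
    rw [inv_le_comm₀ (by positivity) (by norm_num)]; norm_num; linarith
  have hl2 := Real.log_two_lt_d9
  rw [hVeq] at h1
  rw [V_eq_sq_sub_log_sq b] at h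
  push_cast at hlog
  linarith

theorem integral_gt_two_pi_div_three_of_large {a b : ℝ} (ha : 0 < a) (ha1 : a < 1)
    (hb : 1.8 ≤ b) (h : V a - V b = b ^ 2 / 3) :
    2 * π / 3 < ∫ k in a..b, 2 * (√(V a - V k))⁻¹ := by
  have hb0 : 0 < b := by linarith
  have hb2 : 3.24 ≤ b ^ 2 := by nlinarith
  have has := le_mul_inv_of_V_eq ha1 hb h
  set s := b⁻¹ with hs
  have hs0 : 0 < s := inv_pos.2 hb0
  have hbs : b * s = 1 := mul_inv_cancel₀ hb0.ne'
  have hexp : V a + 2 * Real.log b - 2 + s ^ 2 = 4 / 3 * b ^ 2 - 2 + s ^ 2 := by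
    unfold V at h ⊢; linarith
  set R := √(4 / 3 * b ^ 2 - 2 + s ^ 2) with hRdef
  have hpos : 0 < 4 / 3 * b ^ 2 - 2 + s ^ 2 := by nlinarith
  have hR : 0 < R := Real.sqrt_pos.2 hpos
  have hR2 : R ^ 2 = 4 / 3 * b ^ 2 - 2 + s ^ 2 := Real.sq_sqrt hpos.le
  have hlow := tangent_integral_lower_bound ha (by linarith) hR (by nlinarith) (hR2.trans hexp.symm)
  set y := 0.6 * s / R with hy
  have hy0 : 0 ≤ y := by positivity
  have hleft : arcsin ((a - s) / R) ≤ -arcsin y := by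
    rw [← Real.arcsin_neg]
    refine Real.arcsin_le_arcsin ?_
    rw [hy, ← neg_div]
    gcongr
    linarith
  have hy1 : y ≤ 1 := by
    rw [hy, div_le_one hR]
    refine le_of_sq_le_sq ?_ hR.le
    rw [hR2]; nlinarith
  have hy_arc := Real.arcsin_nonneg.2 hy0
  have hright : π / 3 - arcsin y < arcsin ((b - s) / R) := by
    rw [Real.lt_arcsin_iff_sin_lt' ⟨by linarith [Real.arcsin_le_pi_div_two y, pi_pos],
      by linarith [pi_pos]⟩, Real.sin_sub, Real.sin_pi_div_three, Real.cos_pi_div_three,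
      Real.cos_arcsin, Real.sin_arcsin (by linarith) hy1]
    have hsum : (b - s) / R + 1 / 2 * y = (b - 0.7 * s) / R := by rw [hy]; ring
    have hnum : 0 ≤ b - 0.7 * s := by nlinarith
    have hsq : √3 / 2 * √(1 - y ^ 2) < (b - 0.7 * s) / R := by
      refine lt_of_pow_lt_pow_left₀ 2 (by positivity) ?_
      rw [mul_pow, div_pow, Real.sq_sqrt (by norm_num), Real.sq_sqrt (by nlinarith), hy,
        div_pow, div_pow, lt_div_iff₀ (by positivity)]
      have e : (3 : ℝ) / 2 ^ 2 * (1 - (0.6 * s) ^ 2 / R ^ 2) * R ^ 2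
          = 3 / 4 * (R ^ 2 - (0.6 * s) ^ 2) := by field_simp; ring
      rw [e, hR2]
      nlinarith
    linarith
  linarith

theorem le_one_of_lt_four_thirds {b : ℝ}
    (hη : (4 / 3) * b ^ 2 - 2 * Real.log b < 4 / 3) : b ≤ 1 := by
  by_contra! hb
  have h := Real.log_le_sub_one_of_pos (x := b ^ 2) (by positivity)
  rw [Real.log_pow] at h
  push_cast at h
  nlinarith

theorem one_le_of_four_thirds_le {b : ℝ} (hb : √3 / 2 ≤ b)
    (hη : 4 / 3 ≤ (4 / 3) * b ^ 2 - 2 * Real.log b) : 1 ≤ b := by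
  by_contra! hlt
  have hb0 : 0 < b := lt_of_lt_of_le (by positivity) hb
  have hbb : 3 / 4 ≤ b ^ 2 := by
    have h3 : √(3 : ℝ) ^ 2 = 3 := Real.sq_sqrt (by norm_num)
    nlinarith [Real.sqrt_nonneg 3]
  have hb1 : b ^ 2 < 1 := by nlinarith
  have h := log_le_half_sub_inv (u := (b ^ 2)⁻¹) (one_le_inv_iff₀.2 ⟨by positivity, hb1.le⟩)
  rw [Real.log_inv, Real.log_pow, inv_inv] at h
  push_cast at h
  have hi : (b ^ 2)⁻¹ * b ^ 2 = 1 := inv_mul_cancel₀ (by positivity)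
  nlinarith

theorem four_thirds_mul_sq_sub_log_le {b : ℝ} (hb : 1 ≤ b) :
    (4 / 3) * b ^ 2 - 2 * Real.log b ≤ (4 / 3) * b ^ 2 - 2 * (b ^ 2 - 1) / (b ^ 2 + 1) := by
  have h := two_mul_sub_one_div_add_one_le_log (u := b ^ 2) (by nlinarith)
  rw [Real.log_pow] at h
  push_cast at h
  linarith

theorem le_of_le_four_thirds_mul_sq_sub_log {b : ℝ} (hb : 1 ≤ b)
    (hη : 1.38 ≤ (4 / 3) * b ^ 2 - 2 * Real.log b) : 1.058 ≤ b := by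
  by_contra! hlt
  have h := hη.trans (four_thirds_mul_sq_sub_log_le hb)
  have h1 : 2 * (b ^ 2 - 1) / (b ^ 2 + 1) ≤ (4 / 3) * b ^ 2 - 1.38 := by linarith
  rw [div_le_iff₀ (by positivity)] at h1
  have hu : b ^ 2 < 1.119364 := by nlinarith
  have hu1 : 1 ≤ b ^ 2 := by nlinarith
  linarith [mul_nonneg (sub_nonneg.2 hu1) (sub_nonneg.2 hu.le)]

theorem four_thirds_mul_sq_sub_log_le_of_le {b : ℝ} (hb : 1 ≤ b) (hb' : b ≤ 1.09) :
    (4 / 3) * b ^ 2 - 2 * Real.log b ≤ 1.44 := by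
  refine (four_thirds_mul_sq_sub_log_le hb).trans ?_
  have h1 : (4 / 3) * b ^ 2 - 1.44 ≤ 2 * (b ^ 2 - 1) / (b ^ 2 + 1) := by
    rw [le_div_iff₀ (by positivity)]
    have hu : b ^ 2 ≤ 1.1881 := by nlinarith
    have hu1 : 1 ≤ b ^ 2 := by nlinarith
    linarith [mul_nonneg (sub_nonneg.2 hu1) (sub_nonneg.2 hu)]
  linarith

theorem stmt_7 (kmin kA : ℝ → ℝ)
    (hkmin : ∀ η : ℝ, 1 < η → 0 < kmin η ∧ kmin η < 1 ∧ V (kmin η) = η)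
    (hkA : ∀ η : ℝ, 1 + Real.log (4 / 3) ≤ η →
      Real.sqrt 3 / 2 ≤ kA η ∧ (4 / 3) * (kA η) ^ 2 - 2 * Real.log (kA η) = η)
    (η : ℝ) (hη : 1 + Real.log (4 / 3) ≤ η) :
    (π / 3 + ∫ k in (kmin η)..(kA η), 2 * (Real.sqrt (η - V k))⁻¹ > 0.7789 * π) ∧
    (π / 3 + ∫ k in (kmin η)..(kA η), 2 * (Real.sqrt (η - V k))⁻¹ > 2 * π / 3) ∧
    (4 / 3 ≤ η →
      π / 3 + ∫ k in (kmin η)..(kA η), 2 * (Real.sqrt (η - V k))⁻¹ > 0.9456 * π) ∧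
    (1.38 ≤ η →
      π / 3 + ∫ k in (kmin η)..(kA η), 2 * (Real.sqrt (η - V k))⁻¹ > π) := by
  have hlog : 0 < Real.log (4 / 3) := Real.log_pos (by norm_num)
  obtain ⟨ha, ha1, hVa⟩ := hkmin η (by linarith)
  obtain ⟨hb, hbη⟩ := hkA η hη
  generalize kmin η = a at ha ha1 hVa ⊢
  generalize kA η = b at hb hbη ⊢
  have hb0 : 0 < b := lt_of_lt_of_le (by positivity) hb
  have h : V a - V b = b ^ 2 / 3 := by
    rw [hVa, V]
    linarith
  have hV : V b < V a := by
    have : 0 < b ^ 2 := by positivity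
    linarith
  have hab : a < b := by
    by_contra! hba
    rcases hba.eq_or_lt with rfl | hlt
    · exact hV.false
    · exact hV.not_gt (V_lt_V_of_lt_of_le_one hb0 hlt ha1.le)
  subst hVa
  have hlarge (hη' : 1.38 ≤ V a) : 2 * π / 3 < ∫ k in a..b, 2 * (√(V a - V k))⁻¹ := by
    have hb1 := one_le_of_four_thirds_le hb (by linarith)
    have hb2 := le_of_le_four_thirds_mul_sq_sub_log hb1 (by linarith)
    rcases le_total b 1.09 with hc | hc
    · have ha56 := le_of_V_le ha (hbη ▸ four_thirds_mul_sq_sub_log_le_of_le hb1 hc)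
      exact integral_gt_two_pi_div_three_of_quintic ha ha1 hb1 (by norm_num) h
        (fun x hx => cubic_ineq_of_mem_Ioo ⟨ha56.trans_lt hx.1, hx.2⟩)
        (quintic_ineq_of_mem_Icc_left ⟨hb2, hc⟩)
    · rcases le_total b 1.8 with hd | hd
      · exact integral_gt_two_pi_div_three_of_quintic ha ha1 hb1 (by norm_num) h
          (fun x hx => cubic_ineq_of_mem_unit ⟨ha.trans hx.1, hx.2⟩)
          (quintic_ineq_of_mem_Icc_right ⟨hc, hd⟩)
      · exact integral_gt_two_pi_div_three_of_large ha ha1 hd h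
  have hmid (hη' : 4 / 3 ≤ V a) :
      (0.9456 - 1 / 3) * π < ∫ k in a..b, 2 * (√(V a - V k))⁻¹ := by
    rcases le_total (V a) 1.38 with hc | hc
    · exact integral_gt_of_V_le ha ha1 (one_le_of_four_thirds_le hb (by linarith)) hV hc
    · linarith [hlarge hc, pi_pos]
  have hall : (0.7789 - 1 / 3) * π < ∫ k in a..b, 2 * (√(V a - V k))⁻¹ := by
    rcases lt_or_ge (V a) (4 / 3) with hc | hc
    · exact integral_gt_of_le_one ha (le_of_V_le ha (by linarith)) hab hb
        (le_one_of_lt_four_thirds (hbη ▸ hc)) h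
    · linarith [hmid hc, pi_pos]
  refine ⟨by linarith, by linarith [pi_pos], fun hη' => ?_, fun hη' => ?_⟩
  · linarith [hmid hη']
  · linarith [hlarge hη']
end

section
/- On the interval [2/√3, e^{0.15325}], the functions c ↦ h₁(c) + 2h₂(c) and c ↦ h₂(c) are strictly increasing, where h₁(c) = ∫_{π/3}^{2π/3} (1 − R⁻(c·sin ψ)²)⁻¹ dψ and h₂(c) = ∫_{R⁻((√3/2)c)}^{R⁺((√3/2)c)} K(R)/(R·√(c² − K(R)²)) dR. -/
open Real

noncomputable def K (R : ℝ) : ℝ := Real.exp ((R ^ 2 - 1) / 2) / R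

/-- The logarithm of `K` on the positive half-line. -/
noncomputable def logK (R : ℝ) : ℝ := (R ^ 2 - 1) / 2 - log R

lemma K_eq_exp_logK {R : ℝ} (hR : 0 < R) : K R = exp (logK R) := by
  rw [K, logK, exp_sub, exp_log hR]

lemma logK_one : logK 1 = 0 := by simp [logK]

lemma hasDerivAt_logK {R : ℝ} (hR : 0 < R) : HasDerivAt logK (R - R⁻¹) R := by
  have h := ((((hasDerivAt_id R).pow 2).sub_const 1).div_const 2).sub (hasDerivAt_log hR.ne')
  exact h.congr_deriv (by simp)

lemma continuousOn_logK {s : Set ℝ} (hs : ∀ R ∈ s, 0 < R) : ContinuousOn logK s :=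
  fun R hR => (hasDerivAt_logK (hs R hR)).continuousAt.continuousWithinAt

lemma strictAntiOn_logK : StrictAntiOn logK (Set.Ioc 0 1) := by
  refine strictAntiOn_of_deriv_neg (convex_Ioc 0 1) (continuousOn_logK fun R hR => hR.1) ?_
  intro R hR
  rw [interior_Ioc] at hR
  rw [(hasDerivAt_logK hR.1).deriv]
  have := (one_lt_inv₀ hR.1).2 hR.2
  linarith [hR.2]

lemma strictMonoOn_logK : StrictMonoOn logK (Set.Ici 1) := by
  refine strictMonoOn_of_deriv_pos (convex_Ici 1)
    (continuousOn_logK fun R hR => one_pos.trans_le hR) ?_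
  intro R hR
  rw [interior_Ici] at hR
  have hR' : 1 < R := hR
  rw [(hasDerivAt_logK (one_pos.trans hR')).deriv]
  have := inv_lt_one_of_one_lt₀ hR'
  linarith

lemma logK_pos {R : ℝ} (hR : 0 < R) (hR1 : R ≠ 1) : 0 < logK R := by
  rw [← logK_one]
  rcases hR1.lt_or_gt with h | h
  · exact strictAntiOn_logK ⟨hR, h.le⟩ ⟨one_pos, le_rfl⟩ h
  · exact strictMonoOn_logK Set.self_mem_Ici h.le h

lemma log_le_cubic {u : ℝ} (hu : 0 < u) :
    log u ≤ (u - 1) - (u - 1) ^ 2 / 2 + (u - 1) ^ 3 / 3 := by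
  set φ : ℝ → ℝ := fun u => (u - 1) - (u - 1) ^ 2 / 2 + (u - 1) ^ 3 / 3 - log u with hφ
  have hd : ∀ u, 0 < u → HasDerivAt φ ((u - 1) ^ 3 / u) u := by
    intro u hu
    have h1 := (hasDerivAt_id u).sub_const 1
    have h := ((h1.sub ((h1.pow 2).div_const 2)).add ((h1.pow 3).div_const 3)).sub
      (hasDerivAt_log hu.ne')
    refine h.congr_deriv ?_
    simp
    field_simp
    ring
  have h1 : φ 1 = 0 := by simp [hφ]
  suffices h : φ 1 ≤ φ u by rw [h1] at h; simp only [hφ] at h; linarith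
  rcases le_total u 1 with h | h
  · refine antitoneOn_of_deriv_nonpos (convex_Ioc 0 1)
      (fun x hx => (hd x hx.1).continuousAt.continuousWithinAt)
      (fun x hx => ?_) (fun x hx => ?_) ⟨hu, h⟩ ⟨one_pos, le_rfl⟩ h
    all_goals rw [interior_Ioc] at hx
    · exact (hd x hx.1).differentiableAt.differentiableWithinAt
    · rw [(hd x hx.1).deriv]
      refine div_nonpos_of_nonpos_of_nonneg ?_ hx.1.le
      exact Odd.pow_nonpos (by decide) (by linarith [hx.2])
  · refine monotoneOn_of_deriv_nonneg (convex_Ici 1)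
      (fun x hx => (hd x (one_pos.trans_le hx)).continuousAt.continuousWithinAt)
      (fun x hx => ?_) (fun x hx => ?_) Set.self_mem_Ici h h
    all_goals rw [interior_Ici] at hx; have hx' : (1 : ℝ) < x := hx
    · exact (hd x (one_pos.trans hx')).differentiableAt.differentiableWithinAt
    · rw [(hd x (one_pos.trans hx')).deriv]
      exact div_nonneg (pow_nonneg (by linarith) _) (by linarith)

lemma le_four_mul_logK {R : ℝ} (hR : 0 < R) :
    (R ^ 2 - 1) ^ 2 - 2 / 3 * (R ^ 2 - 1) ^ 3 ≤ 4 * logK R := by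
  have h := log_le_cubic (pow_pos hR 2)
  rw [log_pow] at h
  push_cast at h
  unfold logK
  linarith

lemma sq_le_four_mul_logK {R : ℝ} (hR : 0 < R) (hR1 : R ≤ 1) :
    (1 - R ^ 2) ^ 2 ≤ 4 * logK R := by
  have h := le_four_mul_logK hR
  have h1 : R ^ 2 ≤ 1 := pow_le_one₀ hR.le hR1
  have h3 : 0 ≤ (1 - R ^ 2) ^ 3 := pow_nonneg (by linarith) 3
  nlinarith

lemma hasDerivAt_sqrt_logK {R : ℝ} (hR : 0 < R) (hR1 : R ≠ 1) :
    HasDerivAt (fun R => √(logK R)) ((R - R⁻¹) / (2 * √(logK R))) R :=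
  (hasDerivAt_logK hR).sqrt (logK_pos hR hR1).ne'

lemma monotoneOn_sqrt_logK_add_log :
    MonotoneOn (fun R => √(logK R) + log R) (Set.Ioc 0 1) := by
  have hd : ∀ R ∈ interior (Set.Ioc (0 : ℝ) 1), HasDerivAt (fun R => √(logK R) + log R)
      ((R - R⁻¹) / (2 * √(logK R)) + R⁻¹) R := by
    intro R hR
    rw [interior_Ioc] at hR
    exact (hasDerivAt_sqrt_logK hR.1 hR.2.ne).add (hasDerivAt_log hR.1.ne')
  refine monotoneOn_of_deriv_nonneg (convex_Ioc 0 1) ?_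
    (fun R hR => (hd R hR).differentiableAt.differentiableWithinAt) ?_
  · exact (continuousOn_logK fun R hR => hR.1).sqrt.add
      (continuousOn_log.mono fun R hR => hR.1.ne')
  · intro R hR
    rw [(hd R hR).deriv]
    rw [interior_Ioc] at hR
    have hR0 := hR.1
    have hs : 0 < √(logK R) := sqrt_pos.2 (logK_pos hR.1 hR.2.ne)
    have h : (1 - R ^ 2) ≤ 2 * √(logK R) := by
      refine abs_le_of_sq_le_sq' ?_ (by positivity) |>.2
      rw [mul_pow, sq_sqrt (logK_pos hR.1 hR.2.ne).le]
      linarith [sq_le_four_mul_logK hR.1 hR.2.le]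
    have : (R - R⁻¹) / (2 * √(logK R)) + R⁻¹
        = (2 * √(logK R) - (1 - R ^ 2)) / (2 * √(logK R) * R) := by
      field_simp
      ring
    rw [this]
    exact div_nonneg (by linarith) (by positivity)

lemma antitoneOn_sqrt_logK_sub_log :
    AntitoneOn (fun R => 0.92 * √(logK R) - log R) (Set.Icc 1 (√1.23)) := by
  have hd : ∀ R ∈ interior (Set.Icc 1 (√1.23)),
      HasDerivAt (fun R => 0.92 * √(logK R) - log R)
      (0.92 * ((R - R⁻¹) / (2 * √(logK R))) - R⁻¹) R := by
    intro R hR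
    rw [interior_Icc] at hR
    have hR0 := one_pos.trans hR.1
    exact ((hasDerivAt_sqrt_logK hR0 hR.1.ne').const_mul _).sub (hasDerivAt_log hR0.ne')
  refine antitoneOn_of_deriv_nonpos (convex_Icc _ _) ?_
    (fun R hR => (hd R hR).differentiableAt.differentiableWithinAt) ?_
  · exact (continuousOn_const.mul
      (continuousOn_logK fun R hR => one_pos.trans_le hR.1).sqrt).sub
      (continuousOn_log.mono fun R hR => (one_pos.trans_le hR.1).ne')
  · intro R hR
    rw [(hd R hR).deriv]
    rw [interior_Icc] at hR
    have hR0 := one_pos.trans hR.1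
    have hl := logK_pos hR0 hR.1.ne'
    have hs : 0 < √(logK R) := sqrt_pos.2 hl
    have hu : R ^ 2 ≤ 1.23 := (le_sqrt hR0.le (by norm_num)).1 hR.2.le
    have hu1 : 1 ≤ R ^ 2 := one_le_pow₀ hR.1.le
    have h : 0.92 * (R ^ 2 - 1) ≤ 2 * √(logK R) := by
      refine abs_le_of_sq_le_sq' ?_ (by positivity) |>.2
      rw [mul_pow 2, sq_sqrt hl.le]
      have h4 := le_four_mul_logK hR0
      nlinarith [mul_nonneg (sq_nonneg (R ^ 2 - 1)) (sub_nonneg.2 hu)]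
    have : 0.92 * ((R - R⁻¹) / (2 * √(logK R))) - R⁻¹
        = (0.92 * (R ^ 2 - 1) - 2 * √(logK R)) / (2 * √(logK R) * R) := by
      field_simp
    rw [this]
    exact div_nonpos_of_nonpos_of_nonneg (by linarith) (by positivity)

lemma sq_le_of_logK_le {R : ℝ} (hR : 1 ≤ R) (h : logK R ≤ 0.0095) : R ^ 2 ≤ 1.23 := by
  by_contra! hc
  have h0 : (1 : ℝ) ≤ √1.23 := one_le_sqrt.2 (by norm_num)
  have h1 : √1.23 < R := (sqrt_lt' (by linarith)).2 hc
  have h2 := strictMonoOn_logK h0 hR h1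
  have h3 := le_four_mul_logK (one_pos.trans_le h0)
  rw [sq_sqrt (by norm_num)] at h3
  linarith

lemma le_sq_of_logK_le {R : ℝ} (hR0 : 0 < R) (hR : R ≤ 1) (h : logK R ≤ 0.0095) :
    0.8 ≤ R ^ 2 := by
  have := sq_le_four_mul_logK hR0 hR
  nlinarith

lemma log_le_of_logK_le {R : ℝ} (hR : 1 ≤ R) (h : logK R ≤ 0.0095) : log R ≤ 0.1039 := by
  have h1 := log_le_log (by positivity) (sq_le_of_logK_le hR h)
  have h2 := log_le_cubic (u := 1.23) (by norm_num)
  rw [log_pow] at h1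
  norm_num at h1 h2 ⊢
  linarith

lemma neg_le_log_of_logK_le {R : ℝ} (hR0 : 0 < R) (hR : R ≤ 1) (h : logK R ≤ 0.0095) :
    -0.112 ≤ log R := by
  have h1 := log_le_log (by positivity) (le_sq_of_logK_le hR0 hR h)
  have h2 := log_le_cubic (u := 0.8⁻¹) (by norm_num)
  rw [log_pow] at h1
  rw [log_inv] at h2
  norm_num at h1 h2 ⊢
  linarith

lemma inv_sub_inv_le_div_cube {a p q : ℝ} (ha : 0 < a) (hp : a ≤ p) (hq : p ≤ q) :
    p⁻¹ - q⁻¹ ≤ (q ^ 2 - p ^ 2) / (2 * a ^ 3) := by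
  have hp0 : 0 < p := ha.trans_le hp
  have hq0 : 0 < q := hp0.trans_le hq
  have e : p⁻¹ - q⁻¹ = (q ^ 2 - p ^ 2) / (p * q * (p + q)) := by
    field_simp
    ring
  rw [e]
  have h : 2 * a ^ 3 ≤ p * q * (p + q) := by
    calc 2 * a ^ 3 = a * a * (a + a) := by ring
      _ ≤ p * q * (p + q) := by gcongr <;> linarith
  have : p ^ 2 ≤ q ^ 2 := by gcongr
  exact div_le_div_of_nonneg_left (by linarith) (by positivity) h

lemma inv_sub_inv_le_of_sq_sub_sq_eq {p q p' q' : ℝ} (hp : 0 < p) (hpq : p ≤ q) (hp' : p ≤ p')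
    (hq' : q ≤ q') (h : q' ^ 2 - p' ^ 2 = q ^ 2 - p ^ 2) : p'⁻¹ - q'⁻¹ ≤ p⁻¹ - q⁻¹ := by
  have hq0 : 0 < q := hp.trans_le hpq
  have hp0' : 0 < p' := hp.trans_le hp'
  have hq0' : 0 < q' := hq0.trans_le hq'
  have e : p⁻¹ - q⁻¹ = (q ^ 2 - p ^ 2) / (p * q * (p + q)) := by
    field_simp
    ring
  have e' : p'⁻¹ - q'⁻¹ = (q' ^ 2 - p' ^ 2) / (p' * q' * (p' + q')) := by
    field_simp
    ring
  rw [e, e', h]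
  have : p ^ 2 ≤ q ^ 2 := by gcongr
  exact div_le_div_of_nonneg_left (by linarith) (by positivity) (by gcongr)

lemma logK_le_of_mem_Icc {a b R E : ℝ} (ha : 0 < a) (hla : logK a = E)
    (hlb : logK b = E) (hR : R ∈ Set.Icc a b) : logK R ≤ E := by
  rcases le_total R 1 with h | h
  · rw [← hla]
    exact strictAntiOn_logK.antitoneOn ⟨ha, hR.1.trans h⟩ ⟨ha.trans_le hR.1, h⟩ hR.1
  · rw [← hlb]
    exact strictMonoOn_logK.monotoneOn h (h.trans hR.2) hR.2

/-- The density of the polar angle along the trajectory with parameter `c`. -/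
noncomputable def angleDensity (c R : ℝ) : ℝ := K R / (R * √(c ^ 2 - K R ^ 2))

lemma sq_le_of_le_sqrt_three_mul {k c : ℝ} (hk : 0 ≤ k) (h : k ≤ √3 / 2 * c) :
    k ^ 2 ≤ 3 / 4 * c ^ 2 := by
  calc k ^ 2 ≤ (√3 / 2 * c) ^ 2 := by gcongr
    _ = 3 / 4 * c ^ 2 := by rw [mul_pow, div_pow, sq_sqrt (by norm_num)]; norm_num

lemma sq_ge_of_sqrt_three_mul_le {k c : ℝ} (hc : 0 ≤ c) (h : √3 / 2 * c ≤ k) :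
    3 / 4 * c ^ 2 ≤ k ^ 2 := by
  calc 3 / 4 * c ^ 2 = (√3 / 2 * c) ^ 2 := by
        rw [mul_pow, div_pow, sq_sqrt (by norm_num)]; norm_num
    _ ≤ k ^ 2 := by gcongr

lemma continuousOn_angleDensity {a b c : ℝ} (hc : 0 < c) (ha : 0 < a)
    (hK : ∀ R ∈ Set.Icc a b, K R ≤ √3 / 2 * c) :
    ContinuousOn (angleDensity c) (Set.Icc a b) := by
  have hKc : ContinuousOn K (Set.Icc a b) := by
    unfold K
    exact ContinuousOn.div (by fun_prop) continuousOn_id fun R hR => (ha.trans_le hR.1).ne'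
  refine hKc.div (continuousOn_id.mul (continuousOn_const.sub (hKc.pow 2)).sqrt) fun R hR => ?_
  have hR0 : 0 < R := ha.trans_le hR.1
  have hk : 0 < K R := by rw [K_eq_exp_logK hR0]; exact exp_pos _
  have := sq_le_of_le_sqrt_three_mul hk.le (hK R hR)
  have hc2 : 0 < c ^ 2 := by positivity
  exact (mul_pos hR0 (sqrt_pos.2 (by linarith))).ne'

lemma angleDensity_sub_le {c₁ c₂ R : ℝ} (hc₁ : 0 < c₁) (hc : c₁ ≤ c₂) (hR : 0 < R)
    (hK : K R ≤ √3 / 2 * c₁) :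
    angleDensity c₁ R - angleDensity c₂ R ≤ 2 * √3 * ((c₂ ^ 2 - c₁ ^ 2) / c₁ ^ 2) * R⁻¹ := by
  have hk : 0 < K R := by rw [K_eq_exp_logK hR]; exact exp_pos _
  have hk2 := sq_le_of_le_sqrt_three_mul hk.le hK
  have hc2 : c₁ ^ 2 ≤ c₂ ^ 2 := by gcongr
  have hc1 : 0 < c₁ ^ 2 := by positivity
  have h := inv_sub_inv_le_div_cube (a := c₁ / 2) (by positivity)
    (p := √(c₁ ^ 2 - K R ^ 2)) (q := √(c₂ ^ 2 - K R ^ 2))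
    (le_sqrt_of_sq_le (by linarith)) (sqrt_le_sqrt (by linarith))
  rw [sq_sqrt (by linarith), sq_sqrt (by linarith)] at h
  unfold angleDensity
  calc K R / (R * √(c₁ ^ 2 - K R ^ 2)) - K R / (R * √(c₂ ^ 2 - K R ^ 2))
      = K R * R⁻¹ * ((√(c₁ ^ 2 - K R ^ 2))⁻¹ - (√(c₂ ^ 2 - K R ^ 2))⁻¹) := by
        simp only [div_eq_mul_inv, mul_inv]; ring
    _ ≤ K R * R⁻¹ * ((c₂ ^ 2 - K R ^ 2 - (c₁ ^ 2 - K R ^ 2)) / (2 * (c₁ / 2) ^ 3)) := by gcongr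
    _ = K R * (R⁻¹ * (4 * (c₂ ^ 2 - c₁ ^ 2) / c₁ ^ 3)) := by field_simp; ring
    _ ≤ √3 / 2 * c₁ * (R⁻¹ * (4 * (c₂ ^ 2 - c₁ ^ 2) / c₁ ^ 3)) := by
        gcongr
    _ = 2 * √3 * ((c₂ ^ 2 - c₁ ^ 2) / c₁ ^ 2) * R⁻¹ := by field_simp; ring

lemma le_angleDensity {c₁ c₂ R : ℝ} (hc₁ : 0 < c₁) (hc₂ : c₂ ^ 2 ≤ 1.02 * c₁ ^ 2)
    (hR : 0 < R) (hK₁ : √3 / 2 * c₁ ≤ K R) (hK₂ : K R ≤ √3 / 2 * c₂) :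
    1.66 * R⁻¹ ≤ angleDensity c₂ R := by
  have hk : 0 < K R := by rw [K_eq_exp_logK hR]; exact exp_pos _
  have h1 := sq_ge_of_sqrt_three_mul_le hc₁.le hK₁
  have h2 := sq_le_of_le_sqrt_three_mul hk.le hK₂
  have hk2 : 0 < K R ^ 2 := by positivity
  have hs : 0 < √(c₂ ^ 2 - K R ^ 2) := sqrt_pos.2 (by linarith)
  have h : √(c₂ ^ 2 - K R ^ 2) ≤ K R / 1.66 :=
    sqrt_le_iff.2 ⟨by positivity, by rw [div_pow]; norm_num at hc₂ ⊢; linarith⟩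
  unfold angleDensity
  rw [← div_eq_mul_inv, div_le_div_iff₀ hR (by positivity)]
  rw [le_div_iff₀ (by norm_num)] at h
  nlinarith

lemma exp_sub_one_le {t : ℝ} (ht0 : 0 ≤ t) (ht : t ≤ 0.019) : exp t - 1 ≤ 1.02 * t := by
  have h := exp_bound_div_one_sub_of_interval ht0 (by linarith)
  rw [le_div_iff₀ (by linarith)] at h
  nlinarith

lemma integral_angleDensity_sub_ge {c₁ c₂ a₁ b₁ a₂ b₂ : ℝ} (hc₁ : 0 < c₁) (hc : c₁ < c₂)
    (ha₁ : a₁ ∈ Set.Ioc 0 1) (ha₂ : a₂ ∈ Set.Ioc 0 1) (hb₁ : 1 ≤ b₁) (hb₂ : 1 ≤ b₂)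
    (hla₁ : logK a₁ = log (√3 / 2 * c₁)) (hla₂ : logK a₂ = log (√3 / 2 * c₂))
    (hlb₁ : logK b₁ = log (√3 / 2 * c₁)) (hlb₂ : logK b₂ = log (√3 / 2 * c₂))
    (hE : log (√3 / 2 * c₂) ≤ 0.0095) :
    2.88 * (√(log (√3 / 2 * c₂)) - √(log (√3 / 2 * c₁))) ≤
      (∫ R in a₂..b₂, angleDensity c₂ R) - ∫ R in a₁..b₁, angleDensity c₁ R := by
  have hc₂ : 0 < c₂ := hc₁.trans hc
  have hx₁ : 0 < √3 / 2 * c₁ := by positivity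
  have hx₂ : 0 < √3 / 2 * c₂ := by positivity
  have hElt : log (√3 / 2 * c₁) < log (√3 / 2 * c₂) := log_lt_log hx₁ (by gcongr)
  have hratio : (c₂ ^ 2 - c₁ ^ 2) / c₁ ^ 2
      = exp (2 * (log (√3 / 2 * c₂) - log (√3 / 2 * c₁))) - 1 := by
    rw [two_mul, exp_add, exp_sub, exp_log hx₁, exp_log hx₂]
    field_simp
  have hx₁' := exp_log hx₁
  have hx₂' := exp_log hx₂
  set E₁ := log (√3 / 2 * c₁)
  set E₂ := log (√3 / 2 * c₂)
  have hE₁ : 0 ≤ E₁ := by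
    rw [← hla₁, ← logK_one]
    exact strictAntiOn_logK.antitoneOn ha₁ ⟨one_pos, le_rfl⟩ ha₁.2
  have haa : a₂ ≤ a₁ := by
    refine (strictAntiOn_logK.le_iff_ge ha₁ ha₂).1 ?_
    rw [hla₁, hla₂]; exact hElt.le
  have hbb : b₁ ≤ b₂ := by
    refine (strictMonoOn_logK.le_iff_le hb₁ hb₂).1 ?_
    rw [hlb₁, hlb₂]; exact hElt.le
  have hab₁ : a₁ ≤ b₁ := ha₁.2.trans hb₁
  have hr₁ : 0 ≤ √E₁ := sqrt_nonneg _
  have hr₁₂ : √E₁ ≤ √E₂ := sqrt_le_sqrt hElt.le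
  have hr₂ : √E₂ ≤ 0.0975 := sqrt_le_iff.2 ⟨by norm_num, by norm_num at hE ⊢; linarith⟩
  have hEr : E₂ - E₁ ≤ 0.195 * (√E₂ - √E₁) := by
    have h1 := sq_sqrt hE₁
    have h2 := sq_sqrt (hE₁.trans hElt.le)
    nlinarith
  have hra : √E₂ - √E₁ ≤ log a₁ - log a₂ := by
    have := monotoneOn_sqrt_logK_add_log ha₂ ha₁ haa
    simp only [hla₁, hla₂] at this
    linarith
  have hsq {b : ℝ} (hb : 1 ≤ b) (h : logK b ≤ 0.0095) : b ∈ Set.Icc 1 (√1.23) :=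
    ⟨hb, le_sqrt_of_sq_le (sq_le_of_logK_le hb h)⟩
  have hrb : 0.92 * (√E₂ - √E₁) ≤ log b₂ - log b₁ := by
    have := antitoneOn_sqrt_logK_sub_log (hsq hb₁ (by linarith)) (hsq hb₂ (by linarith)) hbb
    simp only [hlb₁, hlb₂] at this
    linarith
  have hlog : log b₁ - log a₁ ≤ 0.2159 := by
    have h1 := log_le_of_logK_le hb₁ (by linarith)
    have h2 := neg_le_log_of_logK_le ha₁.1 ha₁.2 (by linarith)
    linarith
  have hratio_le : (c₂ ^ 2 - c₁ ^ 2) / c₁ ^ 2 ≤ 2.04 * (E₂ - E₁) := by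
    rw [hratio]
    have := exp_sub_one_le (t := 2 * (E₂ - E₁)) (by linarith) (by linarith)
    linarith
  have hsq_le : c₂ ^ 2 ≤ 1.02 * c₁ ^ 2 := by
    have : (c₂ ^ 2 - c₁ ^ 2) / c₁ ^ 2 ≤ 0.02 := by linarith
    rw [div_le_iff₀ (by positivity)] at this
    linarith
  have hK₁ : ∀ R ∈ Set.Icc a₁ b₁, K R ≤ √3 / 2 * c₁ := fun R hR => by
    rw [K_eq_exp_logK (ha₁.1.trans_le hR.1), ← hx₁']
    exact exp_le_exp.2 (logK_le_of_mem_Icc ha₁.1 hla₁ hlb₁ hR)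
  have hK₂ : ∀ R ∈ Set.Icc a₂ b₂, K R ≤ √3 / 2 * c₂ := fun R hR => by
    rw [K_eq_exp_logK (ha₂.1.trans_le hR.1), ← hx₂']
    exact exp_le_exp.2 (logK_le_of_mem_Icc ha₂.1 hla₂ hlb₂ hR)
  have hKa : ∀ R ∈ Set.Icc a₂ a₁, √3 / 2 * c₁ ≤ K R := fun R hR => by
    have hR0 := ha₂.1.trans_le hR.1
    rw [K_eq_exp_logK hR0, ← hx₁', ← hla₁]
    exact exp_le_exp.2 (strictAntiOn_logK.antitoneOn ⟨hR0, hR.2.trans ha₁.2⟩ ha₁ hR.2)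
  have hKb : ∀ R ∈ Set.Icc b₁ b₂, √3 / 2 * c₁ ≤ K R := fun R hR => by
    have hR1 := hb₁.trans hR.1
    rw [K_eq_exp_logK (one_pos.trans_le hR1), ← hx₁', ← hlb₁]
    exact exp_le_exp.2 (strictMonoOn_logK.monotoneOn hb₁ hR1 hR.1)
  have hcont₂ := continuousOn_angleDensity hc₂ ha₂.1 hK₂
  have hint {u v : ℝ} (hu : a₂ ≤ u) (huv : u ≤ v) (hv : v ≤ b₂) :
      IntervalIntegrable (angleDensity c₂) MeasureTheory.volume u v :=
    (hcont₂.mono (Set.Icc_subset_Icc hu hv)).intervalIntegrable_of_Icc huv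
  have hint₁ : IntervalIntegrable (angleDensity c₁) MeasureTheory.volume a₁ b₁ :=
    (continuousOn_angleDensity hc₁ ha₁.1 hK₁).intervalIntegrable_of_Icc hab₁
  have hinv {u v : ℝ} (m : ℝ) (hu : 0 < u) (huv : u ≤ v) :
      IntervalIntegrable (fun R : ℝ => m * R⁻¹) MeasureTheory.volume u v :=
    ((continuousOn_inv₀.mono fun R hR => (hu.trans_le hR.1).ne').intervalIntegrable_of_Icc
      huv).const_mul m
  have hinv_eq {u v : ℝ} (m : ℝ) (hu : 0 < u) (huv : u ≤ v) :
      ∫ R in u..v, m * R⁻¹ = m * (log v - log u) := by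
    rw [intervalIntegral.integral_const_mul, integral_inv_of_pos hu (hu.trans_le huv),
      log_div (hu.trans_le huv).ne' hu.ne']
  have hL : 1.66 * (log a₁ - log a₂) ≤ ∫ R in a₂..a₁, angleDensity c₂ R := by
    rw [← hinv_eq 1.66 ha₂.1 haa]
    exact intervalIntegral.integral_mono_on haa (hinv _ ha₂.1 haa)
      (hint le_rfl haa (hab₁.trans hbb)) fun R hR => le_angleDensity hc₁ hsq_le
        (ha₂.1.trans_le hR.1) (hKa R hR) (hK₂ R ⟨hR.1, hR.2.trans (hab₁.trans hbb)⟩)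
  have hb₁0 : 0 < b₁ := one_pos.trans_le hb₁
  have hU : 1.66 * (log b₂ - log b₁) ≤ ∫ R in b₁..b₂, angleDensity c₂ R := by
    rw [← hinv_eq 1.66 hb₁0 hbb]
    exact intervalIntegral.integral_mono_on hbb (hinv _ hb₁0 hbb)
      (hint (haa.trans hab₁) hbb le_rfl) fun R hR => le_angleDensity hc₁ hsq_le
        (hb₁0.trans_le hR.1) (hKb R hR) (hK₂ R ⟨(haa.trans hab₁).trans hR.1, hR.2⟩)
  have hM : (∫ R in a₁..b₁, angleDensity c₁ R) - ∫ R in a₁..b₁, angleDensity c₂ R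
      ≤ 2 * √3 * ((c₂ ^ 2 - c₁ ^ 2) / c₁ ^ 2) * (log b₁ - log a₁) := by
    rw [← intervalIntegral.integral_sub hint₁ (hint haa hab₁ hbb), ← hinv_eq _ ha₁.1 hab₁]
    exact intervalIntegral.integral_mono_on hab₁ (hint₁.sub (hint haa hab₁ hbb))
      (hinv _ ha₁.1 hab₁) fun R hR =>
        angleDensity_sub_le hc₁ hc.le (ha₁.1.trans_le hR.1) (hK₁ R hR)
  have hM' : 2 * √3 * ((c₂ ^ 2 - c₁ ^ 2) / c₁ ^ 2) * (log b₁ - log a₁)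
      ≤ 0.2977 * (√E₂ - √E₁) := by
    have h3 : √3 ≤ 1.7321 := sqrt_le_iff.2 ⟨by norm_num, by norm_num⟩
    have hpos : 0 ≤ log b₁ - log a₁ := sub_nonneg.2 (log_le_log ha₁.1 hab₁)
    calc 2 * √3 * ((c₂ ^ 2 - c₁ ^ 2) / c₁ ^ 2) * (log b₁ - log a₁)
        ≤ 2 * 1.7321 * (2.04 * (0.195 * (√E₂ - √E₁))) * 0.2159 := by
          have : (c₂ ^ 2 - c₁ ^ 2) / c₁ ^ 2 ≤ 2.04 * (0.195 * (√E₂ - √E₁)) := by linarith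
          have : 0 ≤ (c₂ ^ 2 - c₁ ^ 2) / c₁ ^ 2 :=
            div_nonneg (sub_nonneg.2 (by gcongr)) (by positivity)
          gcongr
      _ ≤ 0.2977 * (√E₂ - √E₁) := by linarith
  have hsplit := intervalIntegral.integral_add_adjacent_intervals
    (hint le_rfl haa (hab₁.trans hbb)) (hint haa hab₁ hbb)
  have hsplit' := intervalIntegral.integral_add_adjacent_intervals
    (hint le_rfl (haa.trans hab₁) hbb) (hint (haa.trans hab₁) hbb le_rfl)
  linarith

lemma two_mul_sq_mul_sub_log_le {p : ℝ} (hp0 : 0 < p) (hp1 : p ≤ 1) :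
    2 * p ^ 2 * (p ^ 3 - 1 - 3 * log p) ≤ (1 - p ^ 3) ^ 2 := by
  set φ : ℝ → ℝ := fun p => (1 - p ^ 3) ^ 2 / p ^ 2 - 2 * (p ^ 3 - 1) + 6 * log p with hφ
  have hd : ∀ p, 0 < p →
      HasDerivAt φ (-2 * (1 - p ^ 3) * ((1 - p) ^ 2 * (1 + 2 * p)) / p ^ 3) p := by
    intro p hp
    have h3 : HasDerivAt (fun p : ℝ => p ^ 3) (3 * p ^ 2) p := by
      simpa using hasDerivAt_pow 3 p
    have h2 : HasDerivAt (fun p : ℝ => p ^ 2) (2 * p) p := by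
      simpa using hasDerivAt_pow 2 p
    have h := ((((h3.const_sub 1).pow 2).div h2 (by positivity)).sub
      ((h3.sub_const 1).const_mul 2)).add ((hasDerivAt_log hp.ne').const_mul 6)
    refine h.congr_deriv ?_
    simp
    field_simp
    ring
  have h1 : φ 1 = 0 := by simp [hφ]
  have h : φ 1 ≤ φ p := by
    refine antitoneOn_of_deriv_nonpos (convex_Ioc 0 1)
      (fun x hx => (hd x hx.1).continuousAt.continuousWithinAt)
      (fun x hx => ?_) (fun x hx => ?_) ⟨hp0, hp1⟩ ⟨one_pos, le_rfl⟩ hp1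
    all_goals rw [interior_Ioc] at hx
    · exact (hd x hx.1).differentiableAt.differentiableWithinAt
    · rw [(hd x hx.1).deriv]
      have hx0 := hx.1
      have hx3 : x ^ 3 ≤ 1 := pow_le_one₀ hx.1.le hx.2.le
      refine div_nonpos_of_nonpos_of_nonneg ?_ (by positivity)
      exact mul_nonpos_of_nonpos_of_nonneg (by linarith) (by positivity)
  rw [h1] at h
  have h' : 0 ≤ φ p * p ^ 2 := by positivity
  have e : φ p * p ^ 2 = (1 - p ^ 3) ^ 2 - 2 * p ^ 2 * (p ^ 3 - 1 - 3 * log p) := by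
    simp only [hφ]
    field_simp
    ring
  linarith

lemma eight_mul_logK_mul_sqrt_le {R : ℝ} (hR0 : 0 < R) (hR1 : R < 1) :
    8 * R ^ 2 * (logK R * √(logK R)) ≤ (1 - R ^ 2) ^ 3 := by
  set p := exp (2 * log R / 3) with hp
  have hp3 : p ^ 3 = R ^ 2 := by
    rw [hp, ← exp_nat_mul]
    push_cast
    rw [mul_div_cancel₀ _ (by norm_num), mul_comm, exp_mul, exp_log hR0]
    exact_mod_cast rfl
  have hlog : 3 * log p = 2 * log R := by rw [hp, log_exp]; ring
  have hp1 : p ≤ 1 := exp_le_one_iff.2 (by linarith [log_neg hR0 hR1])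
  have hL := logK_pos hR0 hR1.ne
  have h := two_mul_sq_mul_sub_log_le (exp_pos _ : 0 < p) hp1
  rw [hp3, hlog] at h
  have h4 : p ^ 2 * (4 * logK R) ≤ (1 - R ^ 2) ^ 2 := by
    unfold logK; linarith
  have hu : 0 ≤ 1 - R ^ 2 := sub_nonneg.2 (pow_le_one₀ hR0.le hR1.le)
  refine abs_le_of_sq_le_sq' ?_ (by positivity) |>.2
  calc (8 * R ^ 2 * (logK R * √(logK R))) ^ 2
      = (p ^ 2 * (4 * logK R)) ^ 3 := by
        rw [← hp3, mul_pow, mul_pow, mul_pow, sq_sqrt hL.le]; ring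
    _ ≤ ((1 - R ^ 2) ^ 2) ^ 3 := by gcongr
    _ = ((1 - R ^ 2) ^ 3) ^ 2 := by ring

lemma antitoneOn_inv_one_sub_sq_sub :
    AntitoneOn (fun R => (1 - R ^ 2)⁻¹ - (2 * √(logK R))⁻¹) (Set.Ioo 0 1) := by
  have hd : ∀ R ∈ Set.Ioo (0 : ℝ) 1,
      HasDerivAt (fun R => (1 - R ^ 2)⁻¹ - (2 * √(logK R))⁻¹)
        ((8 * R ^ 2 * (logK R * √(logK R)) - (1 - R ^ 2) ^ 3) /
          (4 * R * (logK R * √(logK R)) * (1 - R ^ 2) ^ 2)) R := by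
    intro R hR
    have hR0 := hR.1
    have hL := logK_pos hR.1 hR.2.ne
    have hs : 0 < √(logK R) := sqrt_pos.2 hL
    have hu : 0 < 1 - R ^ 2 := sub_pos.2 (pow_lt_one₀ hR.1.le hR.2 two_ne_zero)
    have h2 : HasDerivAt (fun p : ℝ => 1 - p ^ 2) (-(2 * R)) R := by
      simpa using (hasDerivAt_pow 2 R).const_sub 1
    have h := (h2.inv hu.ne').sub
      (((hasDerivAt_sqrt_logK hR.1 hR.2.ne).const_mul 2).inv (by positivity))
    refine h.congr_deriv ?_
    have e : logK R = √(logK R) ^ 2 := (sq_sqrt hL.le).symm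
    generalize √(logK R) = s at e hs
    rw [e]
    field_simp
    ring
  refine antitoneOn_of_deriv_nonpos (convex_Ioo 0 1)
    (fun R hR => (hd R hR).continuousAt.continuousWithinAt)
    (fun R hR => (hd R (interior_subset hR)).differentiableAt.differentiableWithinAt)
    fun R hR => ?_
  have hR' := interior_subset hR
  have hR0 := hR'.1
  have hL := logK_pos hR'.1 hR'.2.ne
  rw [(hd R hR').deriv]
  exact div_nonpos_of_nonpos_of_nonneg
    (by linarith [eight_mul_logK_mul_sqrt_le hR'.1 hR'.2]) (by positivity)

lemma logK_eq_log {R x : ℝ} (hR : 0 < R) (h : K R = x) : logK R = log x := by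
  rw [← h, K_eq_exp_logK hR, log_exp]

lemma sqrt_three_half_mul_exp_le_sin {θ : ℝ} (h0 : 0 ≤ θ) (h1 : θ ≤ 1 / 4) :
    √3 / 2 * exp (0.42 * θ) ≤ sin (π / 3 + θ) := by
  have h3 : √3 * √3 = 3 := mul_self_sqrt (by norm_num)
  have h3u : √3 ≤ 1.7321 := sqrt_le_iff.2 ⟨by norm_num, by norm_num⟩
  have hcos := one_sub_sq_div_two_le_cos (x := θ)
  have hsin : θ - θ ^ 3 / 6 ≤ sin θ := by
    rcases h0.eq_or_lt with rfl | h
    · simp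
    · exact (sin_gt_sub_cube h).le
  have hs : sin (π / 3 + θ) = √3 / 2 * (cos θ + √3 / 3 * sin θ) := by
    rw [sin_add, sin_pi_div_three, cos_pi_div_three]
    linear_combination (-1 / 6 * sin θ) * h3
  rw [hs]
  gcongr
  have h3l : 1.732 ≤ √3 := le_sqrt_of_sq_le (by norm_num)
  have hsin0 : 0 ≤ sin θ := sin_nonneg_of_nonneg_of_le_pi h0 (by linarith [pi_gt_three])
  have hq : 1 + 0.445 * θ ≤ cos θ + √3 / 3 * sin θ := by
    have : 1.732 / 3 * (θ - θ ^ 3 / 6) ≤ √3 / 3 * sin θ := by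
      calc 1.732 / 3 * (θ - θ ^ 3 / 6) ≤ 1.732 / 3 * sin θ := by gcongr
        _ ≤ √3 / 3 * sin θ := by gcongr
    nlinarith [mul_nonneg h0 (sub_nonneg.2 h1), mul_nonneg (sq_nonneg θ) (sub_nonneg.2 h1)]
  refine le_trans ?_ hq
  rw [← le_log_iff_exp_le (by positivity)]
  refine le_trans ?_ (le_log_one_add_of_nonneg (by positivity))
  rw [le_div_iff₀ (by positivity)]
  nlinarith [mul_nonneg h0 (sub_nonneg.2 h1)]

lemma intervalIntegrable_inv_two_mul_sqrt_add {E m a b : ℝ} (hE : 0 ≤ E) (hm : 0 < m)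
    (hab : a ≤ b) :
    IntervalIntegrable (fun ψ => (2 * √(E + m * (ψ - a)))⁻¹) MeasureTheory.volume a b ∧
    ∫ ψ in a..b, (2 * √(E + m * (ψ - a)))⁻¹ = (√(E + m * (b - a)) - √E) / m := by
  have hd : ∀ ψ ∈ Set.Ioo a b, HasDerivAt (fun ψ => √(E + m * (ψ - a)) / m)
      (2 * √(E + m * (ψ - a)))⁻¹ ψ := by
    intro ψ hψ
    have hpos : 0 < E + m * (ψ - a) := by nlinarith [hψ.1]
    have h :=
      (((((hasDerivAt_id ψ).sub_const a).const_mul m).const_add E).sqrt hpos.ne').div_const m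
    refine h.congr_deriv ?_
    simp
    field_simp
  have hc : ContinuousOn (fun ψ => √(E + m * (ψ - a)) / m) (Set.Icc a b) := by fun_prop
  have hi : IntervalIntegrable (fun ψ => (2 * √(E + m * (ψ - a)))⁻¹) MeasureTheory.volume a b := by
    refine intervalIntegral.intervalIntegrable_deriv_of_nonneg (by rwa [Set.uIcc_of_le hab])
      (fun ψ hψ => hd ψ ?_) fun ψ _ => by positivity
    rwa [min_eq_left hab, max_eq_right hab] at hψ
  refine ⟨hi, ?_⟩
  rw [intervalIntegral.integral_eq_sub_of_hasDerivAt_of_le hab hc hd hi]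
  simp
  ring

lemma integral_comp_sin_symm {F : ℝ → ℝ}
    (h : IntervalIntegrable (fun ψ => F (sin ψ)) MeasureTheory.volume (π / 3) (π / 2)) :
    ∫ ψ in (π / 3)..(2 * π / 3), F (sin ψ) = 2 * ∫ ψ in (π / 3)..(π / 2), F (sin ψ) := by
  have e1 : π - π / 2 = π / 2 := by ring
  have e2 : π - π / 3 = 2 * π / 3 := by ring
  have h' := (h.comp_sub_left π).symm
  simp only [sin_pi_sub, e1, e2] at h'
  have hi := intervalIntegral.integral_comp_sub_left (a := π / 3) (b := π / 2)
    (fun ψ => F (sin ψ)) π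
  simp only [sin_pi_sub, e1, e2] at hi
  rw [← intervalIntegral.integral_add_adjacent_intervals h h', ← hi, two_mul]

section

variable {Rm : ℝ → ℝ}

lemma inv_one_sub_sq_sub_le (hRm : ∀ x : ℝ, 1 < x → 0 < Rm x ∧ Rm x < 1 ∧ K (Rm x) = x)
    {x y : ℝ} (hx : 1 < x) (hxy : x ≤ y) :
    (1 - Rm x ^ 2)⁻¹ - (1 - Rm y ^ 2)⁻¹ ≤ (2 * √(log x))⁻¹ - (2 * √(log y))⁻¹ := by
  obtain ⟨hx0, hx1, hxK⟩ := hRm x hx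
  obtain ⟨hy0, hy1, hyK⟩ := hRm y (hx.trans_le hxy)
  have hlx := logK_eq_log hx0 hxK
  have hly := logK_eq_log hy0 hyK
  have hle : Rm y ≤ Rm x := by
    refine (strictAntiOn_logK.le_iff_ge ⟨hx0, hx1.le⟩ ⟨hy0, hy1.le⟩).1 ?_
    rw [hlx, hly]
    exact log_le_log (by linarith) hxy
  have := antitoneOn_inv_one_sub_sq_sub ⟨hy0, hy1⟩ ⟨hx0, hx1⟩ hle
  simp only [hlx, hly] at this
  linarith

lemma antitoneOn_inv_one_sub_sq
    (hRm : ∀ x : ℝ, 1 < x → 0 < Rm x ∧ Rm x < 1 ∧ K (Rm x) = x) :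
    AntitoneOn (fun x => (1 - Rm x ^ 2)⁻¹) (Set.Ioi 1) := by
  intro x hx y hy hxy
  obtain ⟨hx0, hx1, hxK⟩ := hRm x hx
  obtain ⟨hy0, hy1, hyK⟩ := hRm y hy
  have hle : Rm y ≤ Rm x := by
    refine (strictAntiOn_logK.le_iff_ge ⟨hx0, hx1.le⟩ ⟨hy0, hy1.le⟩).1 ?_
    rw [logK_eq_log hx0 hxK, logK_eq_log hy0 hyK]
    exact log_le_log (one_pos.trans hx) hxy
  have : 0 < 1 - Rm x ^ 2 := sub_pos.2 (pow_lt_one₀ hx0.le hx1 two_ne_zero)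
  simp only
  gcongr

lemma inv_one_sub_sq_comp_sub_le
    (hRm : ∀ x : ℝ, 1 < x → 0 < Rm x ∧ Rm x < 1 ∧ K (Rm x) = x)
    {c₁ c₂ s t : ℝ} (hc₁ : 1 ≤ √3 / 2 * c₁) (hc : c₁ ≤ c₂) (ht : 0 < t)
    (hs : √3 / 2 * exp t ≤ s) :
    (1 - Rm (c₁ * s) ^ 2)⁻¹ - (1 - Rm (c₂ * s) ^ 2)⁻¹ ≤
      (2 * √(log (√3 / 2 * c₁) + t))⁻¹ - (2 * √(log (√3 / 2 * c₂) + t))⁻¹ := by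
  have h3 : 0 < √3 / 2 := by positivity
  have hc₁0 : 0 < c₁ := pos_of_mul_pos_right (one_pos.trans_le hc₁) h3.le
  have hc₂0 : 0 < c₂ := hc₁0.trans_le hc
  have hs0 : 0 < s := (by positivity : 0 < √3 / 2 * exp t).trans_le hs
  have hE : 0 ≤ log (√3 / 2 * c₁) := log_nonneg hc₁
  have hlog {c : ℝ} (hc : 0 < c) : log (c * s) = log (√3 / 2 * c) + log (s / (√3 / 2)) := by
    rw [← log_mul (by positivity) (by positivity)]
    congr 1
    field_simp
  have hts : t ≤ log (s / (√3 / 2)) := by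
    rw [le_log_iff_exp_le (by positivity), le_div_iff₀ h3]
    linarith
  have hx : 1 < c₁ * s := by
    refine (log_pos_iff (by positivity)).1 ?_
    rw [hlog hc₁0]
    linarith
  have hE₁₂ : log (√3 / 2 * c₁) ≤ log (√3 / 2 * c₂) := log_le_log (by positivity) (by gcongr)
  refine (inv_one_sub_sq_sub_le hRm hx (by gcongr : c₁ * s ≤ c₂ * s)).trans ?_
  rw [hlog hc₁0, hlog hc₂0]
  have h := inv_sub_inv_le_of_sq_sub_sq_eq (p := √(log (√3 / 2 * c₁) + t))
    (q := √(log (√3 / 2 * c₂) + t)) (p' := √(log (√3 / 2 * c₁) + log (s / (√3 / 2))))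
    (q' := √(log (√3 / 2 * c₂) + log (s / (√3 / 2)))) (sqrt_pos.2 (by linarith))
    (by gcongr) (by gcongr) (by gcongr) (by
      rw [sq_sqrt (by linarith), sq_sqrt (by linarith), sq_sqrt (by linarith),
        sq_sqrt (by linarith)]
      ring)
  simp only [mul_inv]
  linarith

lemma integral_inv_one_sub_sq_sub_le
    (hRm : ∀ x : ℝ, 1 < x → 0 < Rm x ∧ Rm x < 1 ∧ K (Rm x) = x)
    {c₁ c₂ : ℝ} (hc₁ : 1 ≤ √3 / 2 * c₁) (hc : c₁ < c₂)
    (hE : log (√3 / 2 * c₂) ≤ 0.0095) :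
    (∫ ψ in (π / 3)..(2 * π / 3), (1 - Rm (c₁ * sin ψ) ^ 2)⁻¹) -
      (∫ ψ in (π / 3)..(2 * π / 3), (1 - Rm (c₂ * sin ψ) ^ 2)⁻¹) ≤
      5.56 * (√(log (√3 / 2 * c₂)) - √(log (√3 / 2 * c₁))) := by
  have hπ := pi_gt_three
  have hπ' := pi_lt_d4
  have h3 : 0 < √3 / 2 := by positivity
  have hc₁0 : 0 < c₁ := pos_of_mul_pos_right (one_pos.trans_le hc₁) h3.le
  have hc₂0 : 0 < c₂ := hc₁0.trans hc
  have hx₂ : 1 < √3 / 2 * c₂ := hc₁.trans_lt (by gcongr)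
  have hbound {t s : ℝ} := inv_one_sub_sq_comp_sub_le (t := t) (s := s) hRm hc₁ hc.le
  have hElt : log (√3 / 2 * c₁) < log (√3 / 2 * c₂) := log_lt_log (by positivity) (by gcongr)
  have hE₁ : 0 ≤ log (√3 / 2 * c₁) := log_nonneg hc₁
  set E₁ := log (√3 / 2 * c₁)
  set E₂ := log (√3 / 2 * c₂)
  have hr₁ : 0 ≤ √E₁ := sqrt_nonneg _
  have hr₁₂ : √E₁ ≤ √E₂ := sqrt_le_sqrt hElt.le
  have hr₂ : √E₂ ≤ 0.0975 := sqrt_le_iff.2 ⟨by norm_num, by norm_num at hE ⊢; linarith⟩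
  have hEr : E₂ - E₁ ≤ 0.195 * (√E₂ - √E₁) := by
    have h1 := sq_sqrt hE₁
    have h2 := sq_sqrt (hE₁.trans hElt.le)
    nlinarith
  have hsin : ∀ ψ ∈ Set.Icc (π / 3) (2 * π / 3), √3 / 2 ≤ sin ψ := by
    intro ψ hψ
    rw [← sin_pi_div_three]
    rcases le_total ψ (π / 2) with h | h
    · exact sin_le_sin_of_le_of_le_pi_div_two (by linarith) h hψ.1
    · rw [← sin_pi_sub ψ]
      exact sin_le_sin_of_le_of_le_pi_div_two (by linarith) (by linarith) (by linarith [hψ.2])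
  have hone : ∀ ψ ∈ Set.Icc (π / 3) (2 * π / 3), 1 < c₂ * sin ψ := fun ψ hψ => by
    have := mul_le_mul_of_nonneg_left (hsin ψ hψ) hc₂0.le
    linarith
  by_cases hint₁ : IntervalIntegrable (fun ψ => (1 - Rm (c₁ * sin ψ) ^ 2)⁻¹)
    MeasureTheory.volume (π / 3) (π / 2)
  swap
  · rw [intervalIntegral.integral_undef (a := π / 3) (b := 2 * π / 3)
      (f := fun ψ => (1 - Rm (c₁ * sin ψ) ^ 2)⁻¹)]
    · have : 0 ≤ ∫ ψ in (π / 3)..(2 * π / 3), (1 - Rm (c₂ * sin ψ) ^ 2)⁻¹ := by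
        refine intervalIntegral.integral_nonneg (by linarith) fun ψ hψ => ?_
        obtain ⟨h0, h1, -⟩ := hRm _ (hone ψ hψ)
        exact inv_nonneg.2 (sub_nonneg.2 (pow_le_one₀ h0.le h1.le))
      linarith
    · refine fun h => hint₁ (h.mono_set ?_)
      rw [Set.uIcc_of_le (by linarith), Set.uIcc_of_le (by linarith)]
      exact Set.Icc_subset_Icc le_rfl (by linarith)
  have hint₂ : IntervalIntegrable (fun ψ => (1 - Rm (c₂ * sin ψ) ^ 2)⁻¹)
      MeasureTheory.volume (π / 3) (π / 2) := by
    refine AntitoneOn.intervalIntegrable fun ψ hψ χ hχ h => ?_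
    rw [Set.uIcc_of_le (by linarith)] at hψ hχ
    refine antitoneOn_inv_one_sub_sq hRm (hone ψ ⟨hψ.1, by linarith [hψ.2]⟩)
      (hone χ ⟨hχ.1, by linarith [hχ.2]⟩) ?_
    exact mul_le_mul_of_nonneg_left
      (sin_le_sin_of_le_of_le_pi_div_two (by linarith [hψ.1]) hχ.2 h) hc₂0.le
  rw [integral_comp_sin_symm (F := fun s => (1 - Rm (c₁ * s) ^ 2)⁻¹) hint₁,
    integral_comp_sin_symm (F := fun s => (1 - Rm (c₂ * s) ^ 2)⁻¹) hint₂, ← mul_sub,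
    ← intervalIntegral.integral_sub hint₁ hint₂]
  have hint := hint₁.sub hint₂
  have hmem : π / 3 + 1 / 4 ∈ Set.uIcc (π / 3) (π / 2) := by
    rw [Set.uIcc_of_le (by linarith)]
    constructor <;> linarith
  have hintL := hint.mono_set (Set.uIcc_subset_uIcc_left hmem)
  have hintR := hint.mono_set (Set.uIcc_subset_uIcc_right hmem)
  rw [← intervalIntegral.integral_add_adjacent_intervals hintL hintR]
  have hL : ∫ ψ in (π / 3)..(π / 3 + 1 / 4),
      ((1 - Rm (c₁ * sin ψ) ^ 2)⁻¹ - (1 - Rm (c₂ * sin ψ) ^ 2)⁻¹) ≤ (√E₂ - √E₁) / 0.42 := by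
    obtain ⟨hi₁, he₁⟩ := intervalIntegrable_inv_two_mul_sqrt_add (m := 0.42) (a := π / 3)
      (b := π / 3 + 1 / 4) hE₁ (by norm_num) (by linarith)
    obtain ⟨hi₂, he₂⟩ := intervalIntegrable_inv_two_mul_sqrt_add (m := 0.42) (a := π / 3)
      (b := π / 3 + 1 / 4) (hE₁.trans hElt.le) (by norm_num) (by linarith)
    refine (intervalIntegral.integral_mono_on_of_le_Ioo (by linarith) hintL (hi₁.sub hi₂)
      fun ψ hψ => hbound (mul_pos (by norm_num) (sub_pos.2 hψ.1)) ?_).trans ?_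
    · have := sqrt_three_half_mul_exp_le_sin (θ := ψ - π / 3) (by linarith [hψ.1])
        (by linarith [hψ.2])
      rwa [add_sub_cancel] at this
    · rw [intervalIntegral.integral_sub hi₁ hi₂, he₁, he₂, ← sub_div]
      have : √(E₁ + 0.42 * (π / 3 + 1 / 4 - π / 3)) ≤ √(E₂ + 0.42 * (π / 3 + 1 / 4 - π / 3)) := by
        gcongr
      exact div_le_div_of_nonneg_right (by linarith) (by norm_num)
  have hR : ∫ ψ in (π / 3 + 1 / 4)..(π / 2),
      ((1 - Rm (c₁ * sin ψ) ^ 2)⁻¹ - (1 - Rm (c₂ * sin ψ) ^ 2)⁻¹) ≤ 0.3924 * (√E₂ - √E₁) := by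
    have hpt : (2 * √(E₁ + 0.105))⁻¹ - (2 * √(E₂ + 0.105))⁻¹ ≤ 1.434 * (√E₂ - √E₁) := by
      have h := inv_sub_inv_le_div_cube (a := 0.324) (by norm_num)
        (p := √(E₁ + 0.105)) (q := √(E₂ + 0.105))
        (le_sqrt_of_sq_le (by norm_num; linarith)) (by gcongr)
      rw [sq_sqrt (by linarith), sq_sqrt (by linarith)] at h
      simp only [mul_inv]
      norm_num at h hEr ⊢
      linarith
    refine (intervalIntegral.integral_mono_on_of_le_Ioo (by linarith) hintR
      (intervalIntegrable_const (c := 1.434 * (√E₂ - √E₁)))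
      fun ψ hψ => (hbound (t := 0.105) (by norm_num) ?_).trans hpt).trans ?_
    · have := sqrt_three_half_mul_exp_le_sin (θ := 1 / 4) (by norm_num) le_rfl
      norm_num at this ⊢
      exact this.trans
        (sin_le_sin_of_le_of_le_pi_div_two (by linarith) hψ.2.le (by linarith [hψ.1]))
    · rw [intervalIntegral.integral_const, smul_eq_mul]
      nlinarith
  have : (√E₂ - √E₁) / 0.42 ≤ 2.381 * (√E₂ - √E₁) := by
    rw [div_le_iff₀ (by norm_num)]
    linarith
  linarith

end

lemma log_sqrt_three_half_mul_le {c : ℝ} (hc0 : 0 < c) (hc : c ≤ exp 0.15325) :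
    log (√3 / 2 * c) ≤ 0.0095 := by
  have h := sum_range_le_log_div (x := 1 / 7) (by norm_num) (by norm_num) 2
  have e : log (√3 / 2) = -(1 / 2 * log (4 / 3)) := by
    rw [log_div (by positivity) two_ne_zero, log_sqrt (by norm_num),
      log_div (by norm_num) (by norm_num), show (4 : ℝ) = 2 ^ 2 by norm_num, log_pow]
    push_cast
    ring
  have hlog : log c ≤ 0.15325 := (log_le_iff_le_exp hc0).2 hc
  rw [log_mul (by positivity) hc0.ne', e]
  norm_num [Finset.sum_range_succ] at h hlog ⊢
  linarith

theorem stmt_14 (Rm Rp : ℝ → ℝ)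
    (hRm : ∀ x : ℝ, 1 < x → 0 < Rm x ∧ Rm x < 1 ∧ K (Rm x) = x)
    (hRp : ∀ x : ℝ, 1 < x → 1 < Rp x ∧ K (Rp x) = x)
    (hRm1 : Rm 1 = 1) (hRp1 : Rp 1 = 1) :
    StrictMonoOn
      (fun c : ℝ =>
        (∫ ψ in (π / 3)..(2 * π / 3), (1 - (Rm (c * Real.sin ψ)) ^ 2)⁻¹) +
          2 * ∫ R in (Rm (Real.sqrt 3 / 2 * c))..(Rp (Real.sqrt 3 / 2 * c)),
            K R / (R * Real.sqrt (c ^ 2 - (K R) ^ 2)))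
      (Set.Icc (2 / Real.sqrt 3) (Real.exp 0.15325)) ∧
    StrictMonoOn
      (fun c : ℝ =>
        ∫ R in (Rm (Real.sqrt 3 / 2 * c))..(Rp (Real.sqrt 3 / 2 * c)),
          K R / (R * Real.sqrt (c ^ 2 - (K R) ^ 2)))
      (Set.Icc (2 / Real.sqrt 3) (Real.exp 0.15325)) := by
  have hm : ∀ x : ℝ, 1 ≤ x → Rm x ∈ Set.Ioc 0 1 ∧ logK (Rm x) = log x := by
    intro x hx
    rcases hx.eq_or_lt with rfl | hx
    · simp [hRm1, logK_one]
    · obtain ⟨h0, h1, hK⟩ := hRm x hx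
      exact ⟨⟨h0, h1.le⟩, logK_eq_log h0 hK⟩
  have hp : ∀ x : ℝ, 1 ≤ x → 1 ≤ Rp x ∧ logK (Rp x) = log x := by
    intro x hx
    rcases hx.eq_or_lt with rfl | hx
    · simp [hRp1, logK_one]
    · obtain ⟨h1, hK⟩ := hRp x hx
      exact ⟨h1.le, logK_eq_log (one_pos.trans h1) hK⟩
  have hone : ∀ c ∈ Set.Icc (2 / √3) (exp 0.15325), 1 ≤ √3 / 2 * c := by
    intro c hc
    have := (div_le_iff₀ (by positivity)).1 hc.1
    linarith
  have key : ∀ c₁ ∈ Set.Icc (2 / √3) (exp 0.15325), ∀ c₂ ∈ Set.Icc (2 / √3) (exp 0.15325),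
      c₁ < c₂ → 0 < c₁ ∧ log (√3 / 2 * c₂) ≤ 0.0095 ∧
        √(log (√3 / 2 * c₁)) < √(log (√3 / 2 * c₂)) ∧
        2.88 * (√(log (√3 / 2 * c₂)) - √(log (√3 / 2 * c₁))) ≤
          (∫ R in (Rm (√3 / 2 * c₂))..(Rp (√3 / 2 * c₂)), angleDensity c₂ R) -
            ∫ R in (Rm (√3 / 2 * c₁))..(Rp (√3 / 2 * c₁)), angleDensity c₁ R := by
    intro c₁ hc₁ c₂ hc₂ hc
    have h0 : 0 < c₁ := (by positivity : 0 < 2 / √3).trans_le hc₁.1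
    have hE := log_sqrt_three_half_mul_le (h0.trans hc) hc₂.2
    obtain ⟨ha₁, hla₁⟩ := hm _ (hone c₁ hc₁)
    obtain ⟨ha₂, hla₂⟩ := hm _ (hone c₂ hc₂)
    obtain ⟨hb₁, hlb₁⟩ := hp _ (hone c₁ hc₁)
    obtain ⟨hb₂, hlb₂⟩ := hp _ (hone c₂ hc₂)
    refine ⟨h0, hE, ?_, integral_angleDensity_sub_ge h0 hc ha₁ ha₂ hb₁ hb₂ hla₁ hla₂ hlb₁ hlb₂ hE⟩
    exact sqrt_lt_sqrt (log_nonneg (hone c₁ hc₁)) (log_lt_log (by positivity) (by gcongr))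
  simp only [angleDensity] at key
  constructor
  · intro c₁ hc₁ c₂ hc₂ hc
    obtain ⟨-, hE, hr, h⟩ := key c₁ hc₁ c₂ hc₂ hc
    have := integral_inv_one_sub_sq_sub_le hRm (hone c₁ hc₁) hc hE
    simp only
    linarith
  · intro c₁ hc₁ c₂ hc₂ hc
    obtain ⟨-, -, hr, h⟩ := key c₁ hc₁ c₂ hc₂ hc
    simp only
    linarith
end
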